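/- arXiv:2202.00942 — 8 statements merged into one kernel-verified Lean document; each statement's English description precedes it below -/
import Mathlib

section
/- Let Ω ⊆ ℝ² be open and let f : Ω → ℝ and g : Ω → ℝ be C¹ functions satisfying, at every point (x,y) ∈ Ω: ∇f(x,y)·∇g(x,y) = 0, ‖∇f(x,y)‖ > 0, and ‖∇g(x,y)‖ > 0. Let P₁, P₂ ∈ Ω and let X* be a regular C¹ curve in Ω from P₁ to P₂ whose image is contained in the level set {(x,y) ∈ Ω : g(x,y) = g(P₁)}. Then for every C¹ curve X in Ω from P₁ to P₂ one has L_φ(X) ≥ L_φ(X*), where φ(x,y) = ‖∇f(x,y)‖; that is, X* is a weighted length-minimizer with respect to the density ‖∇f‖. -/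
open Set

/-- Euclidean norm of a vector in `ℝ × ℝ`. -/
noncomputable def elen (v : ℝ × ℝ) : ℝ := Real.sqrt (v.1 ^ 2 + v.2 ^ 2)

/-- Euclidean dot product on `ℝ × ℝ`. -/
def dotp (v w : ℝ × ℝ) : ℝ := v.1 * w.1 + v.2 * w.2

/-- The gradient `(u_x, u_y)` of `u : ℝ × ℝ → ℝ` at a point. -/
noncomputable def grad (u : ℝ × ℝ → ℝ) (p : ℝ × ℝ) : ℝ × ℝ :=
  (fderiv ℝ u p (1, 0), fderiv ℝ u p (0, 1))

/-- A C¹ curve in `Ω` from `P₁` to `P₂`, parametrized on `[0,1]`. -/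
def IsC1CurveIn (Ω : Set (ℝ × ℝ)) (P₁ P₂ : ℝ × ℝ) (X : ℝ → ℝ × ℝ) : Prop :=
  ContDiffOn ℝ 1 X (Icc 0 1) ∧ (∀ t ∈ Icc (0:ℝ) 1, X t ∈ Ω) ∧ X 0 = P₁ ∧ X 1 = P₂

/-- Regularity: nonvanishing velocity on `[0,1]`. -/
def IsRegularCurve (X : ℝ → ℝ × ℝ) : Prop :=
  ∀ t ∈ Icc (0:ℝ) 1, derivWithin X (Icc 0 1) t ≠ 0

/-- Weighted length `∫₀¹ φ(X(t)) ‖X'(t)‖ dt` with respect to a density `φ`. -/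
noncomputable def wLen (φ : ℝ × ℝ → ℝ) (X : ℝ → ℝ × ℝ) : ℝ :=
  ∫ t in (0:ℝ)..1, φ (X t) * elen (derivWithin X (Icc 0 1) t)

lemma fderiv_eq_dotp (u : ℝ × ℝ → ℝ) (p v : ℝ × ℝ) :
    fderiv ℝ u p v = dotp (grad u p) v := by
  have hv : v = v.1 • ((1:ℝ), (0:ℝ)) + v.2 • ((0:ℝ), (1:ℝ)) := by
    ext <;> simp
  conv_lhs => rw [hv]
  rw [map_add, map_smul, map_smul]
  simp only [dotp, grad, smul_eq_mul]
  ring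

lemma abs_dotp_le (v w : ℝ × ℝ) : |dotp v w| ≤ elen v * elen w := by
  unfold elen dotp
  rw [← Real.sqrt_mul (by positivity)]
  apply Real.abs_le_sqrt
  nlinarith [sq_nonneg (v.1 * w.2 - v.2 * w.1)]

lemma elen_pos_ne {v : ℝ × ℝ} (h : 0 < elen v) : 0 < v.1 ^ 2 + v.2 ^ 2 :=
  Real.sqrt_pos.mp h

lemma cross_zero {a b c : ℝ × ℝ} (hb : 0 < elen b) (h1 : dotp a b = 0) (h2 : dotp b c = 0) :
    a.1 * c.2 - a.2 * c.1 = 0 := by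
  have hb' := elen_pos_ne hb
  unfold dotp at h1 h2
  have : (b.1 ^ 2 + b.2 ^ 2) * (a.1 * c.2 - a.2 * c.1) = 0 := by
    linear_combination (b.1 * c.2 - b.2 * c.1) * h1 + (b.2 * a.1 - b.1 * a.2) * h2
  rcases mul_eq_zero.mp this with h | h
  · exact absurd h hb'.ne'
  · exact h

lemma abs_dotp_eq {v w : ℝ × ℝ} (h : v.1 * w.2 - v.2 * w.1 = 0) :
    |dotp v w| = elen v * elen w := by
  unfold elen dotp
  rw [← Real.sqrt_mul (by positivity), ← Real.sqrt_sq_eq_abs]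
  congr 1
  linear_combination (-(v.1 * w.2 - v.2 * w.1)) * h

lemma elen_pos {w : ℝ × ℝ} (h : w ≠ 0) : 0 < elen w := by
  unfold elen
  apply Real.sqrt_pos.mpr
  by_contra hc
  apply h
  have h1 : w.1 = 0 := by nlinarith [sq_nonneg w.1, sq_nonneg w.2]
  have h2 : w.2 = 0 := by nlinarith [sq_nonneg w.1, sq_nonneg w.2]
  exact Prod.ext h1 h2

section curve
variable {Ω : Set (ℝ × ℝ)} {P₁ P₂ : ℝ × ℝ} {X : ℝ → ℝ × ℝ} {u : ℝ × ℝ → ℝ}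

lemma curve_deriv (hΩ : IsOpen Ω) (hu : ContDiffOn ℝ 1 u Ω) (hX : IsC1CurveIn Ω P₁ P₂ X)
    {t : ℝ} (ht : t ∈ Icc (0:ℝ) 1) :
    HasDerivWithinAt (fun s => u (X s))
      (dotp (grad u (X t)) (derivWithin X (Icc 0 1) t)) (Icc 0 1) t := by
  have h1 : HasFDerivAt u (fderiv ℝ u (X t)) (X t) :=
    ((hu.differentiableOn one_ne_zero).differentiableAt
      (hΩ.mem_nhds (hX.2.1 t ht))).hasFDerivAt
  have h2 : HasDerivWithinAt X (derivWithin X (Icc 0 1) t) (Icc 0 1) t :=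
    (hX.1.differentiableOn one_ne_zero t ht).hasDerivWithinAt
  rw [← fderiv_eq_dotp]
  exact h1.comp_hasDerivWithinAt t h2

lemma curve_vel_cont (hX : IsC1CurveIn Ω P₁ P₂ X) :
    ContinuousOn (derivWithin X (Icc 0 1)) (Icc 0 1) :=
  hX.1.continuousOn_derivWithin (uniqueDiffOn_Icc one_pos) le_rfl

lemma curve_grad_cont (hΩ : IsOpen Ω) (hu : ContDiffOn ℝ 1 u Ω) (hX : IsC1CurveIn Ω P₁ P₂ X) :
    ContinuousOn (fun t => grad u (X t)) (Icc 0 1) := by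
  have h1 : ContinuousOn (fderiv ℝ u) Ω := hu.continuousOn_fderiv_of_isOpen hΩ le_rfl
  have h2 : ContinuousOn (fun t => fderiv ℝ u (X t)) (Icc 0 1) :=
    h1.comp hX.1.continuousOn hX.2.1
  unfold grad
  exact (h2.clm_apply continuousOn_const).prodMk (h2.clm_apply continuousOn_const)

lemma curve_dot_cont (hΩ : IsOpen Ω) (hu : ContDiffOn ℝ 1 u Ω) (hX : IsC1CurveIn Ω P₁ P₂ X) :
    ContinuousOn (fun t => dotp (grad u (X t)) (derivWithin X (Icc 0 1) t)) (Icc 0 1) := by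
  have h1 := curve_grad_cont hΩ hu hX
  have h2 := curve_vel_cont hX
  unfold dotp
  exact (h1.fst.mul h2.fst).add (h1.snd.mul h2.snd)

lemma curve_len_cont (hΩ : IsOpen Ω) (hu : ContDiffOn ℝ 1 u Ω) (hX : IsC1CurveIn Ω P₁ P₂ X) :
    ContinuousOn (fun t => elen (grad u (X t)) * elen (derivWithin X (Icc 0 1) t))
      (Icc 0 1) := by
  have h1 := curve_grad_cont hΩ hu hX
  have h2 := curve_vel_cont hX
  unfold elen
  exact (((h1.fst.pow 2).add (h1.snd.pow 2)).sqrt).mul (((h2.fst.pow 2).add (h2.snd.pow 2)).sqrt)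

lemma curve_ftc (hΩ : IsOpen Ω) (hu : ContDiffOn ℝ 1 u Ω) (hX : IsC1CurveIn Ω P₁ P₂ X) :
    ∫ t in (0:ℝ)..1, dotp (grad u (X t)) (derivWithin X (Icc 0 1) t) = u P₂ - u P₁ := by
  have := intervalIntegral.integral_eq_sub_of_hasDerivAt_of_le zero_le_one
    (f := fun s => u (X s))
    (fun t ht => (curve_deriv hΩ hu hX ht).continuousWithinAt)
    (fun t ht => (curve_deriv hΩ hu hX (Ioo_subset_Icc_self ht)).hasDerivAt
      (Icc_mem_nhds ht.1 ht.2))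
    ((curve_dot_cont hΩ hu hX).intervalIntegrable_of_Icc zero_le_one)
  rw [this, hX.2.2.1, hX.2.2.2]

lemma curve_lower (hΩ : IsOpen Ω) (hu : ContDiffOn ℝ 1 u Ω) (hX : IsC1CurveIn Ω P₁ P₂ X) :
    |u P₂ - u P₁| ≤ wLen (fun p => elen (grad u p)) X := by
  rw [← curve_ftc hΩ hu hX]
  refine (intervalIntegral.abs_integral_le_integral_abs zero_le_one).trans ?_
  unfold wLen
  refine intervalIntegral.integral_mono_on zero_le_one
    ((curve_dot_cont hΩ hu hX).abs.intervalIntegrable_of_Icc zero_le_one)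
    ((curve_len_cont hΩ hu hX).intervalIntegrable_of_Icc zero_le_one) ?_
  intro t _
  exact abs_dotp_le _ _

end curve

/-- calibration criterion for weighted length-minimizing geodesics. -/
theorem statement0 (Ω : Set (ℝ × ℝ)) (hΩ : IsOpen Ω) (f g : ℝ × ℝ → ℝ)
    (hf : ContDiffOn ℝ 1 f Ω) (hg : ContDiffOn ℝ 1 g Ω)
    (horth : ∀ p ∈ Ω, dotp (grad f p) (grad g p) = 0)
    (hfpos : ∀ p ∈ Ω, 0 < elen (grad f p))
    (hgpos : ∀ p ∈ Ω, 0 < elen (grad g p))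
    (P₁ P₂ : ℝ × ℝ) (hP₁ : P₁ ∈ Ω) (hP₂ : P₂ ∈ Ω)
    (Xstar : ℝ → ℝ × ℝ) (hXstar : IsC1CurveIn Ω P₁ P₂ Xstar) (hreg : IsRegularCurve Xstar)
    (hlevel : ∀ t ∈ Icc (0:ℝ) 1, g (Xstar t) = g P₁)
    (X : ℝ → ℝ × ℝ) (hX : IsC1CurveIn Ω P₁ P₂ X) :
    wLen (fun p => elen (grad f p)) X ≥ wLen (fun p => elen (grad f p)) Xstar := by
  refine ge_iff_le.mpr (le_trans ?_ (curve_lower hΩ hf hX))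
  have hcross : ∀ t ∈ Icc (0:ℝ) 1,
      |dotp (grad f (Xstar t)) (derivWithin Xstar (Icc 0 1) t)| =
        elen (grad f (Xstar t)) * elen (derivWithin Xstar (Icc 0 1) t) := by
    intro t ht
    have hp := hXstar.2.1 t ht
    refine abs_dotp_eq (cross_zero (hgpos _ hp) (horth _ hp) ?_)
    have h1 := curve_deriv hΩ hg hXstar ht
    have h2 : HasDerivWithinAt (fun s => g (Xstar s)) 0 (Icc 0 1) t :=
      (hasDerivWithinAt_const t (Icc 0 1) (g P₁)).congr hlevel (hlevel t ht)
    exact (uniqueDiffOn_Icc one_pos t ht).eq_deriv _ h1 h2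
  have hne : ∀ t ∈ Icc (0:ℝ) 1,
      dotp (grad f (Xstar t)) (derivWithin Xstar (Icc 0 1) t) ≠ 0 := by
    intro t ht
    rw [← abs_pos, hcross t ht]
    exact mul_pos (hfpos _ (hXstar.2.1 t ht)) (elen_pos (hreg t ht))
  have hw : wLen (fun p => elen (grad f p)) Xstar =
      ∫ t in (0:ℝ)..1, |dotp (grad f (Xstar t)) (derivWithin Xstar (Icc 0 1) t)| := by
    unfold wLen
    refine intervalIntegral.integral_congr ?_
    intro t ht
    rw [uIcc_of_le zero_le_one] at ht
    exact (hcross t ht).symm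
  rw [hw, ← curve_ftc hΩ hf hXstar]
  by_cases hall : ∀ t ∈ Icc (0:ℝ) 1,
      0 ≤ dotp (grad f (Xstar t)) (derivWithin Xstar (Icc 0 1) t)
  · refine le_trans (le_of_eq ?_) (le_abs_self _)
    refine intervalIntegral.integral_congr ?_
    intro t ht
    rw [uIcc_of_le zero_le_one] at ht
    exact abs_of_nonneg (hall t ht)
  · push Not at hall
    obtain ⟨a, ha, hneg⟩ := hall
    have hall2 : ∀ t ∈ Icc (0:ℝ) 1,
        dotp (grad f (Xstar t)) (derivWithin Xstar (Icc 0 1) t) ≤ 0 := by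
      intro b hb
      by_contra hc
      obtain ⟨c, hc1, hc2⟩ := isPreconnected_Icc.intermediate_value ha hb
        (curve_dot_cont hΩ hf hXstar) ⟨hneg.le, (not_le.mp hc).le⟩
      exact hne c hc1 hc2
    refine le_trans (le_of_eq ?_) (neg_le_abs _)
    rw [← intervalIntegral.integral_neg]
    refine intervalIntegral.integral_congr ?_
    intro t ht
    rw [uIcc_of_le zero_le_one] at ht
    exact abs_of_nonpos (hall2 t ht)
end

section
/- Let v : ℝ → ℝ be a C¹ function with v(y) > 0 for all y, let c ∈ ℝ, and let Ω ⊆ ℝ² be an open connected set on which 1 − c²·v(y)² > 0. Let g : Ω → ℝ be a C¹ function with partial derivatives ∂g/∂x = 1 and ∂g/∂y = c·v(y)/√(1 − c²·v(y)²) on Ω. Let P₁, P₂ ∈ Ω and let X* be a regular C¹ curve in Ω from P₁ to P₂ whose image is contained in the level set {(x,y) ∈ Ω : g(x,y) = 0}. Then for every C¹ curve X in Ω from P₁ to P₂ one has L_φ(X) ≥ L_φ(X*), where φ(x,y) = 1/v(y). -/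
open Set

/-- The `y`-slope of the calibrating potential. -/
noncomputable def calW (v : ℝ → ℝ) (c : ℝ) (y : ℝ) : ℝ :=
  Real.sqrt (1 - c ^ 2 * (v y) ^ 2) / v y

/-- The calibrating potential. -/
noncomputable def calF (v : ℝ → ℝ) (c : ℝ) (p : ℝ × ℝ) : ℝ :=
  -c * p.1 + ∫ y in (0:ℝ)..p.2, calW v c y

theorem calW_cont (v : ℝ → ℝ) (hv : Continuous v) (hvpos : ∀ y, 0 < v y) (c : ℝ) :
    Continuous (calW v c) := by
  unfold calW
  exact Continuous.div (by fun_prop) hv (fun y => (hvpos y).ne')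

theorem curve_hasDeriv {X : ℝ → ℝ × ℝ} (hX : ContDiffOn ℝ 1 X (Icc 0 1)) {t : ℝ}
    (ht : t ∈ Icc (0:ℝ) 1) :
    HasDerivWithinAt X (derivWithin X (Icc 0 1) t) (Icc 0 1) t :=
  (hX.differentiableOn (by norm_num) t ht).hasDerivWithinAt

theorem curve_deriv_cont {X : ℝ → ℝ × ℝ} (hX : ContDiffOn ℝ 1 X (Icc 0 1)) :
    ContinuousOn (derivWithin X (Icc 0 1)) (Icc 0 1) :=
  hX.continuousOn_derivWithin (uniqueDiffOn_Icc (by norm_num)) (by norm_num)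

/-- Rate of change of the potential along a curve. -/
noncomputable def calD (v : ℝ → ℝ) (c : ℝ) (X : ℝ → ℝ × ℝ) (t : ℝ) : ℝ :=
  -c * (derivWithin X (Icc 0 1) t).1 + calW v c (X t).2 * (derivWithin X (Icc 0 1) t).2

theorem calD_cont (v : ℝ → ℝ) (hv : Continuous v) (hvpos : ∀ y, 0 < v y) (c : ℝ)
    {X : ℝ → ℝ × ℝ} (hX : ContDiffOn ℝ 1 X (Icc 0 1)) :
    ContinuousOn (calD v c X) (Icc 0 1) := by
  have h1 := curve_deriv_cont hX
  have h2 : ContinuousOn (fun t => calW v c (X t).2) (Icc 0 1) :=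
    (calW_cont v hv hvpos c).comp_continuousOn (continuous_snd.comp_continuousOn hX.continuousOn)
  unfold calD
  exact (continuousOn_const.mul (continuous_fst.comp_continuousOn h1)).add
    (h2.mul (continuous_snd.comp_continuousOn h1))

theorem len_cont (v : ℝ → ℝ) (hv : Continuous v) (hvpos : ∀ y, 0 < v y)
    {X : ℝ → ℝ × ℝ} (hX : ContDiffOn ℝ 1 X (Icc 0 1)) :
    ContinuousOn (fun t => 1 / v (X t).2 * elen (derivWithin X (Icc 0 1) t)) (Icc 0 1) := by
  have h1 := curve_deriv_cont hX
  have h2 : Continuous elen := by unfold elen; fun_prop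
  have h3 : Continuous (fun y => 1 / v y) := continuous_const.div hv (fun y => (hvpos y).ne')
  exact (h3.comp_continuousOn (continuous_snd.comp_continuousOn hX.continuousOn)).mul
    (h2.comp_continuousOn h1)

theorem calF_integral (v : ℝ → ℝ) (hv : Continuous v) (hvpos : ∀ y, 0 < v y) (c : ℝ)
    {X : ℝ → ℝ × ℝ} (hX : ContDiffOn ℝ 1 X (Icc 0 1)) :
    ∫ t in (0:ℝ)..1, calD v c X t = calF v c (X 1) - calF v c (X 0) := by
  have hw := calW_cont v hv hvpos c
  have hd : ∀ t ∈ Icc (0:ℝ) 1,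
      HasDerivWithinAt (fun t => calF v c (X t)) (calD v c X t) (Icc 0 1) t := by
    intro t ht
    have h := curve_hasDeriv hX ht
    have h1 : HasDerivWithinAt (fun t => (X t).1) _ (Icc 0 1) t := h.fst
    have h2 : HasDerivWithinAt (fun t => (X t).2) _ (Icc 0 1) t := h.snd
    have h3 : HasDerivAt (fun u => ∫ y in (0:ℝ)..u, calW v c y) (calW v c (X t).2) (X t).2 :=
      intervalIntegral.integral_hasDerivAt_right (hw.intervalIntegrable _ _)
        (hw.stronglyMeasurableAtFilter _ _) hw.continuousAt
    have h4 := HasDerivAt.comp_hasDerivWithinAt t h3 h2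
    exact (h1.const_mul (-c)).add h4
  refine intervalIntegral.integral_eq_sub_of_hasDerivAt_of_le zero_le_one
    (f := fun t => calF v c (X t)) (fun t ht => (hd t ht).continuousWithinAt) ?_ ?_
  · intro t ht
    exact (hd t (Ioo_subset_Icc_self ht)).hasDerivAt (Icc_mem_nhds ht.1 ht.2)
  · apply ContinuousOn.intervalIntegrable
    rw [uIcc_of_le zero_le_one]
    exact calD_cont v hv hvpos c hX

/-- Cauchy-Schwarz for the unit-weighted gradient. -/
theorem cs_bound (V s c a b : ℝ) (hV : 0 < V) (hs : s ^ 2 = 1 - c ^ 2 * V ^ 2) :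
    |-c * a + s / V * b| ≤ 1 / V * Real.sqrt (a ^ 2 + b ^ 2) := by
  have h : -c * a + s / V * b = 1 / V * (-c * V * a + s * b) := by field_simp
  rw [h, abs_mul, abs_of_pos (by positivity : 0 < 1 / V)]
  refine mul_le_mul_of_nonneg_left (Real.abs_le_sqrt ?_) (by positivity)
  have : a ^ 2 + b ^ 2 = (s ^ 2 + c ^ 2 * V ^ 2) * (a ^ 2 + b ^ 2) := by rw [hs]; ring
  rw [this]
  nlinarith [sq_nonneg (s * a + c * V * b)]

theorem cs_eq (V s c a b : ℝ) (hV : 0 < V) (hs0 : 0 < s) (hs : s ^ 2 = 1 - c ^ 2 * V ^ 2)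
    (hab : a + c * V / s * b = 0) :
    1 / V * Real.sqrt (a ^ 2 + b ^ 2) = 1 / (V * s) * |b| ∧
      -c * a + s / V * b = 1 / (V * s) * b := by
  have ha : a = -(c * V / s * b) := by linarith
  have h1 : a ^ 2 + b ^ 2 = (b / s) ^ 2 := by
    rw [ha]
    field_simp
    rw [hs]; ring
  constructor
  · rw [h1, Real.sqrt_sq_eq_abs, abs_div, abs_of_pos hs0]
    field_simp
  · rw [ha]
    field_simp
    rw [hs]; ring

theorem sign_const {f : ℝ → ℝ} (hf : ContinuousOn f (Icc 0 1))
    (h0 : ∀ t ∈ Icc (0:ℝ) 1, f t ≠ 0) :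
    (∀ t ∈ Icc (0:ℝ) 1, 0 < f t) ∨ (∀ t ∈ Icc (0:ℝ) 1, f t < 0) := by
  by_contra! hcon
  obtain ⟨⟨a, ha, ha'⟩, ⟨b, hb, hb'⟩⟩ := hcon
  obtain ⟨t, ht, ht'⟩ := isPreconnected_Icc.intermediate_value ha hb hf ⟨ha', hb'⟩
  exact h0 t ht ht'

theorem wLen_ge (v : ℝ → ℝ) (hv : Continuous v) (hvpos : ∀ y, 0 < v y) (c : ℝ)
    {X : ℝ → ℝ × ℝ} (hX : ContDiffOn ℝ 1 X (Icc 0 1))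
    (hpos : ∀ t ∈ Icc (0:ℝ) 1, 0 < 1 - c ^ 2 * (v (X t).2) ^ 2) :
    |calF v c (X 1) - calF v c (X 0)| ≤ wLen (fun p => 1 / v p.2) X := by
  rw [← calF_integral v hv hvpos c hX]
  refine (intervalIntegral.abs_integral_le_integral_abs zero_le_one).trans ?_
  unfold wLen
  refine intervalIntegral.integral_mono_on zero_le_one ?_ ?_ ?_
  · apply ContinuousOn.intervalIntegrable
    rw [uIcc_of_le zero_le_one]
    exact (calD_cont v hv hvpos c hX).abs
  · apply ContinuousOn.intervalIntegrable
    rw [uIcc_of_le zero_le_one]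
    exact len_cont v hv hvpos hX
  · intro t ht
    exact cs_bound _ _ _ _ _ (hvpos _) (Real.sq_sqrt (hpos t ht).le)

/-- generalized brachistochrone density `1 / v(y)`. -/
theorem statement1 (v : ℝ → ℝ) (hv : ContDiff ℝ 1 v) (hvpos : ∀ y, 0 < v y)
    (c : ℝ) (Ω : Set (ℝ × ℝ)) (hΩ : IsOpen Ω) (hconn : IsConnected Ω)
    (hΩv : ∀ p ∈ Ω, 0 < 1 - c ^ 2 * (v p.2) ^ 2)
    (g : ℝ × ℝ → ℝ) (hg : ContDiffOn ℝ 1 g Ω)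
    (hgx : ∀ p ∈ Ω, fderiv ℝ g p (1, 0) = 1)
    (hgy : ∀ p ∈ Ω, fderiv ℝ g p (0, 1)
      = c * v p.2 / Real.sqrt (1 - c ^ 2 * (v p.2) ^ 2))
    (P₁ P₂ : ℝ × ℝ) (hP₁ : P₁ ∈ Ω) (hP₂ : P₂ ∈ Ω)
    (Xstar : ℝ → ℝ × ℝ) (hXstar : IsC1CurveIn Ω P₁ P₂ Xstar) (hreg : IsRegularCurve Xstar)
    (hlevel : ∀ t ∈ Icc (0:ℝ) 1, g (Xstar t) = 0)
    (X : ℝ → ℝ × ℝ) (hX : IsC1CurveIn Ω P₁ P₂ X) :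
    wLen (fun p => 1 / v p.2) X ≥ wLen (fun p => 1 / v p.2) Xstar := by
  obtain ⟨hXc, hXΩ, hX0, hX1⟩ := hX
  obtain ⟨hSc, hSΩ, hS0, hS1⟩ := hXstar
  have hvc := hv.continuous
  have hge := wLen_ge v hvc hvpos c hXc (fun t ht => hΩv _ (hXΩ t ht))
  refine ge_iff_le.mpr (le_trans ?_ hge)
  have hint := calF_integral v hvc hvpos c hSc
  rw [hX0, hX1]
  rw [hS0, hS1] at hint
  rw [← hint]
  have horth : ∀ t ∈ Icc (0:ℝ) 1, (derivWithin Xstar (Icc 0 1) t).1 +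
      c * v (Xstar t).2 / Real.sqrt (1 - c ^ 2 * (v (Xstar t).2) ^ 2) *
        (derivWithin Xstar (Icc 0 1) t).2 = 0 := by
    intro t ht
    have hΩt := hSΩ t ht
    have hgd : HasFDerivAt g (fderiv ℝ g (Xstar t)) (Xstar t) :=
      ((hg.differentiableOn (by norm_num) _ hΩt).differentiableAt (hΩ.mem_nhds hΩt)).hasFDerivAt
    have h1 := hgd.comp_hasDerivWithinAt t (curve_hasDeriv hSc ht)
    have h2 : HasDerivWithinAt (g ∘ Xstar) 0 (Icc 0 1) t :=
      (hasDerivWithinAt_const t (Icc (0:ℝ) 1) (0:ℝ)).congr hlevel (hlevel t ht)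
    have h3 := (uniqueDiffOn_Icc (zero_lt_one' ℝ) t ht).eq_deriv _ h1 h2
    rw [← hgy _ hΩt]
    generalize derivWithin Xstar (Icc 0 1) t = d at h3 ⊢
    have hd : d = d.1 • ((1:ℝ), (0:ℝ)) + d.2 • ((0:ℝ), (1:ℝ)) := by
      ext <;> simp
    rw [hd, map_add, map_smul, map_smul, hgx _ hΩt] at h3
    simp only [smul_eq_mul] at h3
    linarith
  have hkey := fun t (ht : t ∈ Icc (0:ℝ) 1) =>
    cs_eq (v (Xstar t).2) _ c _ _ (hvpos _) (Real.sqrt_pos.mpr (hΩv _ (hSΩ t ht)))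
      (Real.sq_sqrt (hΩv _ (hSΩ t ht)).le) (horth t ht)
  have hne : ∀ t ∈ Icc (0:ℝ) 1, (derivWithin Xstar (Icc 0 1) t).2 ≠ 0 := by
    intro t ht h
    have h1 := horth t ht
    rw [h, mul_zero, add_zero] at h1
    exact hreg t ht (Prod.ext h1 h)
  rcases sign_const (continuous_snd.comp_continuousOn (curve_deriv_cont hSc)) hne with hs | hs
  · refine le_trans (le_of_eq ?_) (le_abs_self _)
    refine intervalIntegral.integral_congr fun t ht => ?_
    rw [uIcc_of_le zero_le_one] at ht
    have h := hkey t ht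
    have hp : 0 < (derivWithin Xstar (Icc 0 1) t).2 := hs t ht
    rw [abs_of_pos hp] at h
    exact h.1.trans h.2.symm
  · refine le_trans (le_of_eq ?_) (neg_le_abs _)
    rw [← intervalIntegral.integral_neg]
    refine intervalIntegral.integral_congr fun t ht => ?_
    rw [uIcc_of_le zero_le_one] at ht
    have h := hkey t ht
    have hp : (derivWithin Xstar (Icc 0 1) t).2 < 0 := hs t ht
    rw [abs_of_neg hp, mul_neg] at h
    exact h.1.trans (congrArg Neg.neg h.2.symm)
end

section
/- Let Ω ⊆ ℂ be open, let h : Ω → ℂ be holomorphic with h'(z) ≠ 0 for all z ∈ Ω, and write p = Re h and q = Im h. Fix α ∈ ℝ and let C_α = {z ∈ Ω : (sin α)·p(z) + (cos α)·q(z) = 0}. Let P₁, P₂ ∈ C_α and let X* be a regular C¹ curve in Ω from P₁ to P₂ whose image is contained in C_α. Then for every C¹ curve X in Ω from P₁ to P₂ one has L_φ(X) ≥ L_φ(X*), where φ(z) = |h'(z)| (which equals the Euclidean norm of the gradient of p). In other words, level curves of harmonic conjugate combinations of p and q are weighted length-minimizers with respect to the density ‖∇p‖ = |h'|. -/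
open Set

/-- A C¹ curve in `Ω ⊆ ℂ` from `P₁` to `P₂`, parametrized on `[0,1]`. -/
def IsC1CurveInC (Ω : Set ℂ) (P₁ P₂ : ℂ) (X : ℝ → ℂ) : Prop :=
  ContDiffOn ℝ 1 X (Icc 0 1) ∧ (∀ t ∈ Icc (0:ℝ) 1, X t ∈ Ω) ∧ X 0 = P₁ ∧ X 1 = P₂

/-- Regularity: nonvanishing velocity on `[0,1]`. -/
def IsRegularCurveC (X : ℝ → ℂ) : Prop :=
  ∀ t ∈ Icc (0:ℝ) 1, derivWithin X (Icc 0 1) t ≠ 0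

/-- Weighted length `∫₀¹ φ(X(t)) ‖X'(t)‖ dt` with respect to a density `φ`
(the norm on `ℂ` is the Euclidean norm of `ℝ²`). -/
noncomputable def wLenC (φ : ℂ → ℝ) (X : ℝ → ℂ) : ℝ :=
  ∫ t in (0:ℝ)..1, φ (X t) * ‖derivWithin X (Icc 0 1) t‖

theorem aux_curve (Ω : Set ℂ) (hΩ : IsOpen Ω) (h : ℂ → ℂ)
    (hh : DifferentiableOn ℂ h Ω) (P₁ P₂ : ℂ) (X : ℝ → ℂ) (hX : IsC1CurveInC Ω P₁ P₂ X) :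
    ContinuousOn (fun t => deriv h (X t) * derivWithin X (Icc 0 1) t) (Icc (0:ℝ) 1) ∧
    (∀ t ∈ Icc (0:ℝ) 1, HasDerivWithinAt (fun t => h (X t))
      (deriv h (X t) * derivWithin X (Icc 0 1) t) (Icc 0 1) t) ∧
    ∫ t in (0:ℝ)..1, deriv h (X t) * derivWithin X (Icc 0 1) t = h P₂ - h P₁ := by
  obtain ⟨hc, hm, h0, h1⟩ := hX
  have hcont : ContinuousOn (fun t => deriv h (X t) * derivWithin X (Icc 0 1) t)
      (Icc (0:ℝ) 1) := by
    refine ContinuousOn.mul ?_ ?_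
    · exact ((hh.deriv hΩ).continuousOn).comp hc.continuousOn hm
    · exact hc.continuousOn_derivWithin (uniqueDiffOn_Icc zero_lt_one) le_rfl
  have hder : ∀ t ∈ Icc (0:ℝ) 1, HasDerivWithinAt (fun t => h (X t))
      (deriv h (X t) * derivWithin X (Icc 0 1) t) (Icc 0 1) t := by
    intro t ht
    have a := (hh.differentiableAt (hΩ.mem_nhds (hm t ht))).hasDerivAt
    have b := ((hc.differentiableOn one_ne_zero) t ht).hasDerivWithinAt
    exact a.comp_hasDerivWithinAt t b
  refine ⟨hcont, hder, ?_⟩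
  rw [intervalIntegral.integral_eq_sub_of_hasDerivAt_of_le (f := fun t => h (X t)) zero_le_one
    (fun t ht => (hder t ht).continuousWithinAt)
    (fun t ht => (hder t (Ioo_subset_Icc_self ht)).hasDerivAt (Icc_mem_nhds ht.1 ht.2))]
  · simp only [h0, h1]
  · exact ContinuousOn.intervalIntegrable (by rwa [uIcc_of_le zero_le_one])

/-- level curves of harmonic functions are weighted length-minimizers
for the density `|h'|`. -/
theorem statement2 (Ω : Set ℂ) (hΩ : IsOpen Ω) (h : ℂ → ℂ)
    (hh : DifferentiableOn ℂ h Ω) (hh' : ∀ z ∈ Ω, deriv h z ≠ 0)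
    (α : ℝ) (P₁ P₂ : ℂ)
    (hP₁ : P₁ ∈ Ω) (hP₁' : Real.sin α * (h P₁).re + Real.cos α * (h P₁).im = 0)
    (hP₂ : P₂ ∈ Ω) (hP₂' : Real.sin α * (h P₂).re + Real.cos α * (h P₂).im = 0)
    (Xstar : ℝ → ℂ) (hXstar : IsC1CurveInC Ω P₁ P₂ Xstar) (hreg : IsRegularCurveC Xstar)
    (hlevel : ∀ t ∈ Icc (0:ℝ) 1,
      Real.sin α * (h (Xstar t)).re + Real.cos α * (h (Xstar t)).im = 0)
    (X : ℝ → ℂ) (hX : IsC1CurveInC Ω P₁ P₂ X) :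
    wLenC (fun z => ‖deriv h z‖) X ≥ wLenC (fun z => ‖deriv h z‖) Xstar := by
  obtain ⟨-, -, iX⟩ := aux_curve Ω hΩ h hh P₁ P₂ X hX
  obtain ⟨cS, dS, iS⟩ := aux_curve Ω hΩ h hh P₁ P₂ Xstar hXstar
  have hXm := hXstar.2.1
  simp only [wLenC, ← norm_mul]
  have lower : ‖h P₂ - h P₁‖ ≤
      ∫ t in (0:ℝ)..1, ‖deriv h (X t) * derivWithin X (Icc 0 1) t‖ := by
    rw [← iX]
    exact intervalIntegral.norm_integral_le_integral_norm zero_le_one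
  refine le_trans ?_ lower
  set F : ℝ → ℂ := fun t => deriv h (Xstar t) * derivWithin Xstar (Icc 0 1) t with hF
  have hFne : ∀ t ∈ Icc (0:ℝ) 1, F t ≠ 0 := fun t ht =>
    mul_ne_zero (hh' _ (hXm t ht)) (hreg t ht)
  set c : ℂ := ⟨Real.cos α, Real.sin α⟩ with hcdef
  have hcn : ‖c‖ = 1 := by
    rw [← sq_eq_sq₀ (norm_nonneg _) zero_le_one, Complex.sq_norm, Complex.normSq_apply]
    simp only [hcdef]
    nlinarith [Real.sin_sq_add_cos_sq α]
  have him : ∀ t ∈ Icc (0:ℝ) 1, (c * F t).im = 0 := by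
    intro t ht
    have a : HasDerivWithinAt (fun t => (c * h (Xstar t)).im) (c * F t).im (Icc 0 1) t :=
      Complex.imCLM.hasFDerivAt.comp_hasDerivWithinAt t ((dS t ht).const_mul c)
    have b : HasDerivWithinAt (fun t => (c * h (Xstar t)).im) 0 (Icc 0 1) t := by
      refine (hasDerivWithinAt_const t (Icc (0:ℝ) 1) (0:ℝ)).congr_of_mem ?_ ht
      intro s hs
      have := hlevel s hs
      simp only [Complex.mul_im, hcdef]
      linarith
    exact (uniqueDiffOn_Icc zero_lt_one t ht).eq_deriv _ a b
  have hG : ∀ t ∈ Icc (0:ℝ) 1, (((c * F t).re : ℝ) : ℂ) = c * F t := fun t ht =>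
    Complex.ext (by simp) (by rw [him t ht]; simp)
  have hGne : ∀ t ∈ Icc (0:ℝ) 1, (c * F t).re ≠ 0 := by
    intro t ht h0
    have e := hG t ht
    rw [h0, Complex.ofReal_zero] at e
    have c0 : c ≠ 0 := by
      intro e
      rw [e, norm_zero] at hcn
      exact zero_ne_one hcn
    exact mul_ne_zero c0 (hFne t ht) e.symm
  have hGc : ContinuousOn (fun t => (c * F t).re) (Icc (0:ℝ) 1) :=
    Complex.continuous_re.comp_continuousOn (continuousOn_const.mul cS)
  have hnorm : ∀ t ∈ Icc (0:ℝ) 1, ‖F t‖ = |(c * F t).re| := by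
    intro t ht
    rw [← Real.norm_eq_abs, ← Complex.norm_real, hG t ht, norm_mul c, hcn, one_mul]
  have hsign : ∃ σ : ℂ, ‖σ‖ = 1 ∧ ∀ t ∈ Icc (0:ℝ) 1, ((‖F t‖ : ℝ) : ℂ) = σ * (c * F t) := by
    by_cases hp : ∀ t ∈ Icc (0:ℝ) 1, 0 < (c * F t).re
    · refine ⟨1, by simp, fun t ht => ?_⟩
      rw [hnorm t ht, abs_of_pos (hp t ht), hG t ht, one_mul]
    · push Not at hp
      obtain ⟨s, hs, hs0⟩ := hp
      refine ⟨-1, by simp, fun t ht => ?_⟩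
      have ht0 : (c * F t).re ≤ 0 := by
        by_contra! hpos
        obtain ⟨u, hu, hu0⟩ := isPreconnected_Icc.intermediate_value hs ht hGc ⟨hs0, hpos.le⟩
        exact hGne u hu hu0
      rw [hnorm t ht, abs_of_nonpos ht0, Complex.ofReal_neg, hG t ht, neg_one_mul]
  obtain ⟨σ, hσ, hFσ⟩ := hsign
  have key : ((∫ t in (0:ℝ)..1, ‖F t‖ : ℝ) : ℂ) = σ * (c * (h P₂ - h P₁)) := by
    rw [← intervalIntegral.integral_ofReal, ← iS, ← intervalIntegral.integral_const_mul,
      ← intervalIntegral.integral_const_mul]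
    refine intervalIntegral.integral_congr fun t ht => ?_
    rw [uIcc_of_le zero_le_one] at ht
    exact hFσ t ht
  calc (∫ t in (0:ℝ)..1, ‖F t‖) ≤ ‖((∫ t in (0:ℝ)..1, ‖F t‖ : ℝ) : ℂ)‖ := by
        rw [Complex.norm_real]; exact Real.le_norm_self _
    _ = ‖h P₂ - h P₁‖ := by rw [key, norm_mul, norm_mul, hσ, hcn, one_mul, one_mul]
end

section
/- Let Ω = (0,∞) × (0,∞) and fix λ > 0. Let C_λ = {(x,y) ∈ Ω : x^(2/3) + y^(2/3) = λ} be the astroid. Let P₁, P₂ ∈ C_λ and let X* be a regular C¹ curve in Ω from P₁ to P₂ whose image is contained in C_λ. Then for every C¹ curve X in Ω from P₁ to P₂ one has L_φ(X) ≥ L_φ(X*), where φ(x,y) = √(x^(2/3) + y^(2/3)). That is, arcs of the astroid are weighted length-minimizers for the density √(x^(2/3) + y^(2/3)). -/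
open Set

/-- Derivative of the calibration function along a curve with velocity `v` at the point `p`. -/
noncomputable def calG (X : ℝ → ℝ × ℝ) (t : ℝ) : ℝ :=
  (X t).1 ^ ((1:ℝ)/3) * (derivWithin X (Icc 0 1) t).1
    - (X t).2 ^ ((1:ℝ)/3) * (derivWithin X (Icc 0 1) t).2

/-- The calibration function. -/
noncomputable def calU (p : ℝ × ℝ) : ℝ := 3 / 4 * (p.1 ^ ((4:ℝ)/3) - p.2 ^ ((4:ℝ)/3))

lemma cal_comp {P₁ P₂ : ℝ × ℝ} {X : ℝ → ℝ × ℝ}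
    (hX : IsC1CurveIn (Ioi (0:ℝ) ×ˢ Ioi (0:ℝ)) P₁ P₂ X) :
    ContinuousOn (fun t => (X t).1) (Icc 0 1) ∧ ContinuousOn (fun t => (X t).2) (Icc 0 1) ∧
    ContinuousOn (fun t => (derivWithin X (Icc 0 1) t).1) (Icc 0 1) ∧
    ContinuousOn (fun t => (derivWithin X (Icc 0 1) t).2) (Icc 0 1) ∧
    (∀ t ∈ Icc (0:ℝ) 1, 0 < (X t).1 ∧ 0 < (X t).2) ∧
    (∀ t ∈ Icc (0:ℝ) 1,
      HasDerivWithinAt (fun t => (X t).1) (derivWithin X (Icc 0 1) t).1 (Icc 0 1) t ∧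
      HasDerivWithinAt (fun t => (X t).2) (derivWithin X (Icc 0 1) t).2 (Icc 0 1) t) := by
  obtain ⟨hc, hm, -, -⟩ := hX
  have h1 := hc.continuousOn
  have h2 := hc.continuousOn_derivWithin (uniqueDiffOn_Icc zero_lt_one) le_rfl
  refine ⟨h1.fst, h1.snd, h2.fst, h2.snd, fun t ht => ?_, fun t ht => ?_⟩
  · have := hm t ht
    simpa [mem_prod] using this
  · have hd : HasDerivWithinAt X (derivWithin X (Icc 0 1) t) (Icc 0 1) t :=
      ((hc.differentiableOn one_ne_zero) t ht).hasDerivWithinAt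
    have := hd.hasFDerivWithinAt
    exact ⟨by simpa using this.fst.hasDerivWithinAt, by simpa using this.snd.hasDerivWithinAt⟩

lemma calG_cont {P₁ P₂ : ℝ × ℝ} {X : ℝ → ℝ × ℝ}
    (hX : IsC1CurveIn (Ioi (0:ℝ) ×ˢ Ioi (0:ℝ)) P₁ P₂ X) : ContinuousOn (calG X) (Icc 0 1) := by
  obtain ⟨a, b, c, d, -, -⟩ := cal_comp hX
  unfold calG
  exact ((a.rpow_const fun _ _ => Or.inr (by norm_num)).mul c).sub
    ((b.rpow_const fun _ _ => Or.inr (by norm_num)).mul d)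

lemma calG_int {P₁ P₂ : ℝ × ℝ} {X : ℝ → ℝ × ℝ}
    (hX : IsC1CurveIn (Ioi (0:ℝ) ×ˢ Ioi (0:ℝ)) P₁ P₂ X) :
    ∫ t in (0:ℝ)..1, calG X t = calU P₂ - calU P₁ := by
  have hG := calG_cont hX
  obtain ⟨a, b, c, d, hp, hd⟩ := cal_comp hX
  have key : ∀ t ∈ Icc (0:ℝ) 1,
      HasDerivWithinAt (fun t => calU (X t)) (calG X t) (Icc 0 1) t := by
    intro t ht
    obtain ⟨d1, d2⟩ := hd t ht
    obtain ⟨p1, p2⟩ := hp t ht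
    have e1 := d1.rpow_const (p := (4:ℝ)/3) (Or.inl p1.ne')
    have e2 := d2.rpow_const (p := (4:ℝ)/3) (Or.inl p2.ne')
    have := (e1.sub e2).const_mul (3/4)
    unfold calU calG
    refine this.congr_deriv ?_
    norm_num
    ring
  have := intervalIntegral.integral_eq_sub_of_hasDerivAt_of_le (zero_le_one' ℝ)
    (f := fun t => calU (X t)) (f' := calG X) (fun t ht => (key t ht).continuousWithinAt)
    (fun t ht => (key t (Ioo_subset_Icc_self ht)).hasDerivAt (Icc_mem_nhds ht.1 ht.2))
    (hG.intervalIntegrable_of_Icc zero_le_one)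
  rw [this, hX.2.2.1, hX.2.2.2]

lemma sq_third {x : ℝ} (hx : 0 < x) : x ^ ((2:ℝ)/3) = (x ^ ((1:ℝ)/3)) ^ 2 := by
  rw [← Real.rpow_natCast, ← Real.rpow_mul hx.le]; norm_num

lemma cal_identity {P₁ P₂ : ℝ × ℝ} {X : ℝ → ℝ × ℝ}
    (hX : IsC1CurveIn (Ioi (0:ℝ) ×ˢ Ioi (0:ℝ)) P₁ P₂ X) (t : ℝ) (ht : t ∈ Icc (0:ℝ) 1) :
    Real.sqrt ((X t).1 ^ ((2:ℝ)/3) + (X t).2 ^ ((2:ℝ)/3)) * elen (derivWithin X (Icc 0 1) t)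
     = Real.sqrt ((calG X t) ^ 2 + ((X t).2 ^ ((1:ℝ)/3) * (derivWithin X (Icc 0 1) t).1
    + (X t).1 ^ ((1:ℝ)/3) * (derivWithin X (Icc 0 1) t).2) ^ 2) := by
  obtain ⟨-, -, -, -, hp, -⟩ := cal_comp hX
  obtain ⟨p1, p2⟩ := hp t ht
  rw [elen, ← Real.sqrt_mul (by positivity), sq_third p1, sq_third p2, calG]
  congr 1
  ring

lemma wLen_ge_s3 {P₁ P₂ : ℝ × ℝ} {X : ℝ → ℝ × ℝ}
    (hX : IsC1CurveIn (Ioi (0:ℝ) ×ˢ Ioi (0:ℝ)) P₁ P₂ X) :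
    |calU P₂ - calU P₁| ≤
      wLen (fun p => Real.sqrt (p.1 ^ ((2:ℝ)/3) + p.2 ^ ((2:ℝ)/3))) X := by
  obtain ⟨a, b, c, d, hp, hd⟩ := cal_comp hX
  have hG := calG_cont hX
  rw [← calG_int hX]
  refine (intervalIntegral.abs_integral_le_integral_abs zero_le_one).trans ?_
  unfold wLen
  refine intervalIntegral.integral_mono_on zero_le_one
    (hG.abs.intervalIntegrable_of_Icc zero_le_one) ?_ ?_
  · refine ContinuousOn.intervalIntegrable_of_Icc zero_le_one ?_
    unfold elen
    exact (((a.rpow_const fun _ _ => Or.inr (by norm_num)).add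
      (b.rpow_const fun _ _ => Or.inr (by norm_num))).sqrt).mul ((c.pow 2).add (d.pow 2)).sqrt
  · intro t ht
    rw [cal_identity hX t ht]
    exact Real.abs_le_sqrt (le_add_of_nonneg_right (sq_nonneg _))

lemma wLen_star {l : ℝ} (hl : 0 < l) {P₁ P₂ : ℝ × ℝ} {X : ℝ → ℝ × ℝ}
    (hX : IsC1CurveIn (Ioi (0:ℝ) ×ˢ Ioi (0:ℝ)) P₁ P₂ X)
    (hreg : IsRegularCurve X)
    (hlevel : ∀ t ∈ Icc (0:ℝ) 1, (X t).1 ^ ((2:ℝ)/3) + (X t).2 ^ ((2:ℝ)/3) = l) :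
    wLen (fun p => Real.sqrt (p.1 ^ ((2:ℝ)/3) + p.2 ^ ((2:ℝ)/3))) X
      = |calU P₂ - calU P₁| := by
  obtain ⟨a, b, c, d, hp, hd⟩ := cal_comp hX
  have hG := calG_cont hX
  have habs : ∀ t ∈ Icc (0:ℝ) 1, Real.sqrt ((X t).1 ^ ((2:ℝ)/3) + (X t).2 ^ ((2:ℝ)/3)) *
      elen (derivWithin X (Icc 0 1) t) = |calG X t| := by
    intro t ht
    obtain ⟨d1, d2⟩ := hd t ht
    obtain ⟨p1, p2⟩ := hp t ht
    have e1 := d1.rpow_const (p := (2:ℝ)/3) (Or.inl p1.ne')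
    have e2 := d2.rpow_const (p := (2:ℝ)/3) (Or.inl p2.ne')
    have e3 := e1.add e2
    have e4 : HasDerivWithinAt (fun _ : ℝ => l) 0 (Icc 0 1) t := hasDerivWithinAt_const _ _ _
    have e5 := e4.congr (f₁ := (fun t => (X t).1 ^ ((2:ℝ)/3)) + fun t => (X t).2 ^ ((2:ℝ)/3))
      (fun s hs => hlevel s hs) (hlevel t ht)
    have e6 := (uniqueDiffOn_Icc zero_lt_one t ht).eq_deriv _ e3 e5
    have r : ∀ x : ℝ, 0 < x → x ^ ((2:ℝ)/3 - 1) = (x ^ ((1:ℝ)/3))⁻¹ := by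
      intro x hx
      rw [← Real.rpow_neg hx.le]; norm_num
    rw [r _ p1, r _ p2] at e6
    have q1 : 0 < (X t).1 ^ ((1:ℝ)/3) := by positivity
    have q2 : 0 < (X t).2 ^ ((1:ℝ)/3) := by positivity
    rw [cal_identity hX t ht]
    have : (X t).2 ^ ((1:ℝ)/3) * (derivWithin X (Icc 0 1) t).1
        + (X t).1 ^ ((1:ℝ)/3) * (derivWithin X (Icc 0 1) t).2 = 0 := by
      generalize (X t).1 ^ ((1:ℝ)/3) = A at *
      generalize (X t).2 ^ ((1:ℝ)/3) = B at *
      field_simp at e6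
      linarith
    rw [this]
    simp [Real.sqrt_sq_eq_abs]
  have hne : ∀ t ∈ Icc (0:ℝ) 1, calG X t ≠ 0 := by
    intro t ht h0
    have := habs t ht
    rw [hlevel t ht, h0, abs_zero] at this
    have hs : Real.sqrt l ≠ 0 := (Real.sqrt_pos.2 hl).ne'
    have h1 := (mul_eq_zero.1 this).resolve_left hs
    unfold elen at h1
    rw [Real.sqrt_eq_zero (by positivity)] at h1
    apply hreg t ht
    ext
    · simp only [Prod.fst_zero]; nlinarith [sq_nonneg (derivWithin X (Icc 0 1) t).1, sq_nonneg (derivWithin X (Icc 0 1) t).2]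
    · simp only [Prod.snd_zero]; nlinarith [sq_nonneg (derivWithin X (Icc 0 1) t).1, sq_nonneg (derivWithin X (Icc 0 1) t).2]
  have hw : wLen (fun p => Real.sqrt (p.1 ^ ((2:ℝ)/3) + p.2 ^ ((2:ℝ)/3))) X
      = ∫ t in (0:ℝ)..1, |calG X t| := by
    unfold wLen
    refine intervalIntegral.integral_congr fun t ht => ?_
    rw [uIcc_of_le zero_le_one] at ht
    exact habs t ht
  rw [hw, ← calG_int hX]
  have hsign : (∀ t ∈ Icc (0:ℝ) 1, 0 ≤ calG X t) ∨ (∀ t ∈ Icc (0:ℝ) 1, calG X t ≤ 0) := by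
    by_contra! hcon
    obtain ⟨⟨s, hs, hs'⟩, r, hr, hr'⟩ := hcon
    obtain ⟨z, hz, hz'⟩ := isPreconnected_Icc.intermediate_value hs hr hG ⟨hs'.le, hr'.le⟩
    exact hne z hz hz'
  rcases hsign with h | h
  · rw [abs_of_nonneg (intervalIntegral.integral_nonneg zero_le_one h)]
    refine intervalIntegral.integral_congr fun t ht => ?_
    rw [uIcc_of_le zero_le_one] at ht
    exact abs_of_nonneg (h t ht)
  · rw [← abs_neg, ← intervalIntegral.integral_neg, abs_of_nonneg
      (intervalIntegral.integral_nonneg zero_le_one fun t ht => neg_nonneg.2 (h t ht))]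
    refine intervalIntegral.integral_congr fun t ht => ?_
    rw [uIcc_of_le zero_le_one] at ht
    exact abs_of_nonpos (h t ht)

/-- arcs of the astroid `x^(2/3) + y^(2/3) = λ` are weighted
length-minimizers for the density `√(x^(2/3) + y^(2/3))` in the open quadrant. -/
theorem statement3 (l : ℝ) (hl : 0 < l) (P₁ P₂ : ℝ × ℝ)
    (hP₁ : P₁ ∈ Ioi (0:ℝ) ×ˢ Ioi (0:ℝ)) (hP₁' : P₁.1 ^ ((2:ℝ)/3) + P₁.2 ^ ((2:ℝ)/3) = l)
    (hP₂ : P₂ ∈ Ioi (0:ℝ) ×ˢ Ioi (0:ℝ)) (hP₂' : P₂.1 ^ ((2:ℝ)/3) + P₂.2 ^ ((2:ℝ)/3) = l)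
    (Xstar : ℝ → ℝ × ℝ)
    (hXstar : IsC1CurveIn (Ioi (0:ℝ) ×ˢ Ioi (0:ℝ)) P₁ P₂ Xstar)
    (hreg : IsRegularCurve Xstar)
    (hlevel : ∀ t ∈ Icc (0:ℝ) 1,
      (Xstar t).1 ^ ((2:ℝ)/3) + (Xstar t).2 ^ ((2:ℝ)/3) = l)
    (X : ℝ → ℝ × ℝ) (hX : IsC1CurveIn (Ioi (0:ℝ) ×ˢ Ioi (0:ℝ)) P₁ P₂ X) :
    wLen (fun p => Real.sqrt (p.1 ^ ((2:ℝ)/3) + p.2 ^ ((2:ℝ)/3))) X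
      ≥ wLen (fun p => Real.sqrt (p.1 ^ ((2:ℝ)/3) + p.2 ^ ((2:ℝ)/3))) Xstar := by
  rw [wLen_star hl hXstar hreg hlevel]
  exact wLen_ge_s3 hX
end

section
/- Fix ρ > 0 and let Ω = ℝ × (−2ρ, 0). Let C = {(x,y) ∈ Ω : x − ρ·arccos(1 + y/ρ) + ρ·√(1 − (1 + y/ρ)²) = 0} (a half-arch of a cycloid). Let P₁, P₂ ∈ C and let X* be a regular C¹ curve in Ω from P₁ to P₂ whose image is contained in C. Then for every C¹ curve X in Ω from P₁ to P₂ one has L_φ(X) ≥ L_φ(X*), where φ(x,y) = 1/√(−y). That is, the half cycloid is a weighted length-minimizer for the brachistochrone density 1/√(−y). -/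
open Set

lemma aux_s (ρ : ℝ) (hρ : 0 < ρ) (y : ℝ) (hy : y ∈ Ioo (-(2 * ρ)) 0) :
    0 < 1 - (1 + y / ρ) ^ 2 ∧ -1 < 1 + y / ρ ∧ 1 + y / ρ < 1 := by
  obtain ⟨h1, h2⟩ := hy
  have h3 : -2 < y / ρ := by rw [lt_div_iff₀ hρ]; linarith
  have h4 : y / ρ < 0 := div_neg_of_neg_of_pos h2 hρ
  refine ⟨by nlinarith, by linarith, by linarith⟩

lemma aux_sq (ρ : ℝ) (hρ : 0 < ρ) (y : ℝ) (hy : y ∈ Ioo (-(2 * ρ)) 0) (v : ℝ × ℝ) :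
    (Real.sqrt (2 * ρ) * (1 / Real.sqrt (-y) * elen v)) ^ 2
      = 2 / (1 - (1 + y / ρ)) * (v.1 ^ 2 + v.2 ^ 2) := by
  have h2 := hy.2
  rw [mul_pow, mul_pow, elen, div_pow, Real.sq_sqrt (by positivity), Real.sq_sqrt (by linarith),
    Real.sq_sqrt (by positivity)]
  have : y ≠ 0 := h2.ne
  have : ρ ≠ 0 := hρ.ne'
  have e : 1 - (1 + y / ρ) = -y / ρ := by ring
  rw [e]
  field_simp

lemma alg_le (z s a b : ℝ) (hs : 0 < s) (h : s ^ 2 = 1 - z ^ 2) (h1 : -1 < z) (h2 : z < 1) :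
    (a - b * (1 + z) / s) ^ 2 ≤ 2 / (1 - z) * (a ^ 2 + b ^ 2) := by
  have hz : 0 < 1 - z := by linarith
  have e : 2 / (1 - z) * (a ^ 2 + b ^ 2) - (a - b * (1 + z) / s) ^ 2
      = (a * (1 + z) / s + b) ^ 2 := by
    have e1 : 2 / (1 - z) = 1 + ((1 + z) / s) ^ 2 := by
      rw [div_pow, h]
      have : (1 - z ^ 2) = (1 - z) * (1 + z) := by ring
      have h3 : (1 + z) ≠ 0 := by linarith
      rw [this]; field_simp; ring
    rw [e1]; ring
  nlinarith [sq_nonneg (a * (1 + z) / s + b)]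

lemma alg_eq (z s a b : ℝ) (hs : 0 < s) (h : s ^ 2 = 1 - z ^ 2) (h1 : -1 < z) (h2 : z < 1)
    (hab : a = - (b * (1 - z) / s)) :
    (a - b * (1 + z) / s) ^ 2 = 2 / (1 - z) * (a ^ 2 + b ^ 2) := by
  have hz : 0 < 1 - z := by linarith
  have h0 : a * (1 + z) / s + b = 0 := by
    have : (1 - z) * (1 + z) = s ^ 2 := by rw [h]; ring
    have h3 : a * (1 + z) / s = - (b * ((1 - z) * (1 + z)) / s ^ 2) := by
      rw [hab]; field_simp
    rw [h3, this]; field_simp; ring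
  have e : 2 / (1 - z) * (a ^ 2 + b ^ 2) - (a - b * (1 + z) / s) ^ 2
      = (a * (1 + z) / s + b) ^ 2 := by
    have e1 : 2 / (1 - z) = 1 + ((1 + z) / s) ^ 2 := by
      rw [div_pow, h]
      have : (1 - z ^ 2) = (1 - z) * (1 + z) := by ring
      have h3 : (1 + z) ≠ 0 := by linarith
      rw [this]; field_simp; ring
    rw [e1]; ring
  rw [h0] at e
  linarith

noncomputable def pot (ρ : ℝ) (p : ℝ × ℝ) : ℝ :=
  p.1 + ρ * Real.arccos (1 + p.2 / ρ) + ρ * Real.sqrt (1 - (1 + p.2 / ρ) ^ 2)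

noncomputable def dpot (ρ : ℝ) (X : ℝ → ℝ × ℝ) (t : ℝ) : ℝ :=
  (derivWithin X (Icc 0 1) t).1 - (derivWithin X (Icc 0 1) t).2 * (1 + (1 + (X t).2 / ρ))
    / Real.sqrt (1 - (1 + (X t).2 / ρ) ^ 2)

noncomputable def spd (ρ : ℝ) (X : ℝ → ℝ × ℝ) (t : ℝ) : ℝ :=
  Real.sqrt (2 * ρ) * (1 / Real.sqrt (-(X t).2) * elen (derivWithin X (Icc 0 1) t))

section
variable {ρ : ℝ} (hρ : 0 < ρ) {P₁ P₂ : ℝ × ℝ} {X : ℝ → ℝ × ℝ}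
  (hX : IsC1CurveIn ((univ : Set ℝ) ×ˢ Ioo (-(2 * ρ)) 0) P₁ P₂ X)
include hX

lemma cont_deriv : ContinuousOn (derivWithin X (Icc 0 1)) (Icc 0 1) :=
  hX.1.continuousOn_derivWithin (uniqueDiffOn_Icc one_pos) le_rfl

include hρ

lemma hasDeriv_parts {t : ℝ} (ht : t ∈ Icc (0:ℝ) 1) :
    HasDerivWithinAt (fun t => (X t).1) (derivWithin X (Icc 0 1) t).1 (Icc 0 1) t ∧
    HasDerivWithinAt (fun t => ρ * Real.arccos (1 + (X t).2 / ρ))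
      (-((derivWithin X (Icc 0 1) t).2 / Real.sqrt (1 - (1 + (X t).2 / ρ) ^ 2))) (Icc 0 1) t ∧
    HasDerivWithinAt (fun t => ρ * Real.sqrt (1 - (1 + (X t).2 / ρ) ^ 2))
      (-((derivWithin X (Icc 0 1) t).2 * (1 + (X t).2 / ρ)
        / Real.sqrt (1 - (1 + (X t).2 / ρ) ^ 2))) (Icc 0 1) t := by
  have hd := ((hX.1.differentiableOn one_ne_zero) t ht).hasDerivWithinAt
  have hy := (hX.2.1 t ht).2
  obtain ⟨h1, h2, h3⟩ := aux_s ρ hρ _ hy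
  have hs := Real.sqrt_pos.2 h1
  have d1 : HasDerivWithinAt (fun t => (X t).1) (derivWithin X (Icc 0 1) t).1 (Icc 0 1) t :=
    (hasFDerivAt_fst (𝕜 := ℝ) (p := X t)).comp_hasDerivWithinAt t hd
  have d2 : HasDerivWithinAt (fun t => (X t).2) (derivWithin X (Icc 0 1) t).2 (Icc 0 1) t :=
    (hasFDerivAt_snd (𝕜 := ℝ) (p := X t)).comp_hasDerivWithinAt t hd
  have dz := (d2.div_const ρ).const_add 1
  refine ⟨d1, ?_, ?_⟩
  · have := ((Real.hasDerivAt_arccos h2.ne' h3.ne).comp_hasDerivWithinAt t dz).const_mul ρ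
    refine this.congr_deriv ?_
    field_simp
  · have := (((dz.pow 2).const_sub 1).sqrt h1.ne').const_mul ρ
    refine this.congr_deriv ?_
    simp only [Nat.cast_ofNat, Pi.pow_apply, Nat.add_one_sub_one, pow_one]
    generalize Real.sqrt (1 - (1 + (X t).2 / ρ) ^ 2) = s at hs
    field_simp

lemma hasDeriv_pot {t : ℝ} (ht : t ∈ Icc (0:ℝ) 1) :
    HasDerivWithinAt (fun t => pot ρ (X t)) (dpot ρ X t) (Icc 0 1) t := by
  obtain ⟨d1, d2, d3⟩ := hasDeriv_parts hρ hX ht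
  refine ((d1.add d2).add d3).congr_deriv ?_
  rw [dpot]; ring

lemma cont_dpot : ContinuousOn (dpot ρ X) (Icc 0 1) := by
  have hc := cont_deriv hX
  have hx := hX.1.continuousOn
  unfold dpot
  have hne : ∀ t ∈ Icc (0:ℝ) 1, Real.sqrt (1 - (1 + (X t).2 / ρ) ^ 2) ≠ 0 := fun t ht =>
    (Real.sqrt_pos.2 (aux_s ρ hρ _ (hX.2.1 t ht).2).1).ne'
  fun_prop (disch := assumption)

lemma cont_spd : ContinuousOn (spd ρ X) (Icc 0 1) := by
  have hc := cont_deriv hX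
  have hx := hX.1.continuousOn
  unfold spd elen
  have hne : ∀ t ∈ Icc (0:ℝ) 1, Real.sqrt (-(X t).2) ≠ 0 := fun t ht =>
    (Real.sqrt_pos.2 (neg_pos.2 (hX.2.1 t ht).2.2)).ne'
  fun_prop (disch := assumption)

lemma int_dpot : ∫ t in (0:ℝ)..1, dpot ρ X t = pot ρ P₂ - pot ρ P₁ := by
  have h := intervalIntegral.integral_eq_sub_of_hasDerivAt_of_le (a := 0) (b := 1) zero_le_one
    (f := fun t => pot ρ (X t)) (f' := dpot ρ X)
    (fun t ht => (hasDeriv_pot hρ hX ht).continuousWithinAt)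
    (fun t ht => (hasDeriv_pot hρ hX (Ioo_subset_Icc_self ht)).hasDerivAt (Icc_mem_nhds ht.1 ht.2))
    ((cont_dpot hρ hX).intervalIntegrable_of_Icc zero_le_one)
  rw [h, hX.2.2.1, hX.2.2.2]

omit hX hρ in
lemma spd_nonneg (t : ℝ) : 0 ≤ spd ρ X t := by
  unfold spd elen; positivity

lemma abs_dpot_le {t : ℝ} (ht : t ∈ Icc (0:ℝ) 1) : |dpot ρ X t| ≤ spd ρ X t := by
  have hy := (hX.2.1 t ht).2
  obtain ⟨h1, h2, h3⟩ := aux_s ρ hρ _ hy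
  refine abs_le_of_sq_le_sq ?_ (spd_nonneg t)
  rw [spd, aux_sq ρ hρ _ hy]
  exact alg_le _ _ _ _ (Real.sqrt_pos.2 h1) (Real.sq_sqrt h1.le) h2 h3

lemma int_spd : ∫ t in (0:ℝ)..1, spd ρ X t
    = Real.sqrt (2 * ρ) * wLen (fun p => 1 / Real.sqrt (-p.2)) X := by
  unfold spd wLen
  rw [intervalIntegral.integral_const_mul]

lemma lower : |pot ρ P₂ - pot ρ P₁| ≤ ∫ t in (0:ℝ)..1, spd ρ X t := by
  rw [← int_dpot hρ hX]
  refine (intervalIntegral.abs_integral_le_integral_abs zero_le_one).trans ?_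
  exact intervalIntegral.integral_mono_on zero_le_one
    ((cont_dpot hρ hX).abs.intervalIntegrable_of_Icc zero_le_one)
    ((cont_spd hρ hX).intervalIntegrable_of_Icc zero_le_one)
    (fun t ht => abs_dpot_le hρ hX ht)

lemma upper (hreg : IsRegularCurve X)
    (hlevel : ∀ t ∈ Icc (0:ℝ) 1, (X t).1 - ρ * Real.arccos (1 + (X t).2 / ρ)
      + ρ * Real.sqrt (1 - (1 + (X t).2 / ρ) ^ 2) = 0) :
    ∫ t in (0:ℝ)..1, spd ρ X t ≤ |pot ρ P₂ - pot ρ P₁| := by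
  have hne : ∀ {t}, t ∈ Icc (0:ℝ) 1 → spd ρ X t ≠ 0 := by
    intro t ht
    have hy := (hX.2.1 t ht).2
    have h0 := hreg t ht
    have : 0 < (derivWithin X (Icc 0 1) t).1 ^ 2 + (derivWithin X (Icc 0 1) t).2 ^ 2 := by
      by_contra hcon
      apply h0
      apply Prod.ext
      · show _ = (0:ℝ)
        nlinarith [sq_nonneg (derivWithin X (Icc 0 1) t).1, sq_nonneg (derivWithin X (Icc 0 1) t).2]
      · show _ = (0:ℝ)
        nlinarith [sq_nonneg (derivWithin X (Icc 0 1) t).1, sq_nonneg (derivWithin X (Icc 0 1) t).2]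
    have h2 : 0 < -(X t).2 := neg_pos.2 hy.2
    unfold spd elen
    positivity
  have hsq : EqOn (dpot ρ X ^ 2) (spd ρ X ^ 2) (Icc 0 1) := by
    intro t ht
    have hy := (hX.2.1 t ht).2
    obtain ⟨h1, h2, h3⟩ := aux_s ρ hρ _ hy
    obtain ⟨d1, d2, d3⟩ := hasDeriv_parts hρ hX ht
    have hd := (d1.sub d2).add d3
    have h0 : HasDerivWithinAt (fun _ : ℝ => (0:ℝ)) 0 (Icc 0 1) t := hasDerivWithinAt_const ..
    have hd0 := h0.congr (f₁ := fun t => (X t).1 - ρ * Real.arccos (1 + (X t).2 / ρ)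
      + ρ * Real.sqrt (1 - (1 + (X t).2 / ρ) ^ 2)) hlevel (hlevel t ht)
    have hu := (uniqueDiffOn_Icc (one_pos (α := ℝ)) t ht).eq_deriv _ hd hd0
    simp only [Pi.pow_apply]
    rw [spd, aux_sq ρ hρ _ hy]
    refine alg_eq _ _ _ _ (Real.sqrt_pos.2 h1) (Real.sq_sqrt h1.le) h2 h3 ?_
    linear_combination hu
  have hu : uIcc (0:ℝ) 1 = Icc 0 1 := uIcc_of_le zero_le_one
  rw [← int_dpot hρ hX]
  rcases isPreconnected_Icc.eq_or_eq_neg_of_sq_eq (cont_dpot hρ hX) (cont_spd hρ hX) hsq hne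
    with h | h
  · rw [intervalIntegral.integral_congr (f := dpot ρ X) (g := spd ρ X) (by rw [hu]; exact h)]
    exact le_abs_self _
  · rw [intervalIntegral.integral_congr (f := dpot ρ X) (g := fun t => - spd ρ X t)
      (by rw [hu]; exact h), intervalIntegral.integral_neg, abs_neg]
    exact le_abs_self _

end

/-- the half cycloid is a weighted length-minimizer for the
brachistochrone density `1/√(−y)` in the strip `ℝ × (−2ρ, 0)`. -/
theorem statement7 (ρ : ℝ) (hρ : 0 < ρ) (P₁ P₂ : ℝ × ℝ)
    (hP₁ : P₁ ∈ (univ : Set ℝ) ×ˢ Ioo (-(2 * ρ)) 0)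
    (hP₁' : P₁.1 - ρ * Real.arccos (1 + P₁.2 / ρ)
      + ρ * Real.sqrt (1 - (1 + P₁.2 / ρ) ^ 2) = 0)
    (hP₂ : P₂ ∈ (univ : Set ℝ) ×ˢ Ioo (-(2 * ρ)) 0)
    (hP₂' : P₂.1 - ρ * Real.arccos (1 + P₂.2 / ρ)
      + ρ * Real.sqrt (1 - (1 + P₂.2 / ρ) ^ 2) = 0)
    (Xstar : ℝ → ℝ × ℝ)
    (hXstar : IsC1CurveIn ((univ : Set ℝ) ×ˢ Ioo (-(2 * ρ)) 0) P₁ P₂ Xstar)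
    (hreg : IsRegularCurve Xstar)
    (hlevel : ∀ t ∈ Icc (0:ℝ) 1, (Xstar t).1 - ρ * Real.arccos (1 + (Xstar t).2 / ρ)
      + ρ * Real.sqrt (1 - (1 + (Xstar t).2 / ρ) ^ 2) = 0)
    (X : ℝ → ℝ × ℝ) (hX : IsC1CurveIn ((univ : Set ℝ) ×ˢ Ioo (-(2 * ρ)) 0) P₁ P₂ X) :
    wLen (fun p => 1 / Real.sqrt (-p.2)) X ≥ wLen (fun p => 1 / Real.sqrt (-p.2)) Xstar := by
  have h1 := (upper hρ hXstar hreg hlevel).trans (lower hρ hX)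
  rw [int_spd hρ hX, int_spd hρ hXstar] at h1
  exact le_of_mul_le_mul_left h1 (Real.sqrt_pos.2 (by positivity))
end

section
/- Fix ρ > 0 and let Ω = ℝ × (−2ρ, 0). Define g, f : Ω → ℝ by g(x,y) = x − ρ·arccos(1 + y/ρ) + ρ·√(1 − (1 + y/ρ)²) and f(x,y) = (1/√(2ρ))·(−x + ρ·arcsin(1 + y/ρ) − ρ·√(1 − (1 + y/ρ)²)). Then at every point of Ω: (i) ∇f·∇g = 0, and (ii) ‖∇f(x,y)‖ = 1/√(−y). -/
open Set

theorem grad_split (a dφ : ℝ) (φ : ℝ → ℝ) (p : ℝ × ℝ) (h : HasDerivAt φ dφ p.2)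
    (u : ℝ × ℝ → ℝ) (hu : ∀ w, u w = a * w.1 + φ w.2) : grad u p = (a, dφ) := by
  have h1 : HasFDerivAt (fun w : ℝ × ℝ => a * w.1) (a • ContinuousLinearMap.fst ℝ ℝ ℝ) p :=
    (hasFDerivAt_fst (𝕜 := ℝ) (p := p)).const_mul a
  have h2 : HasFDerivAt (fun w : ℝ × ℝ => φ w.2) (dφ • ContinuousLinearMap.snd ℝ ℝ ℝ) p :=
    h.comp_hasFDerivAt p (hasFDerivAt_snd (𝕜 := ℝ) (p := p))
  have h3 := h1.add h2
  have hueq : u = (fun w : ℝ × ℝ => a * w.1) + (fun w : ℝ × ℝ => φ w.2) := by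
    funext w; simp [hu]
  rw [← hueq] at h3
  simp [grad, h3.fderiv]

/-- the calibration pair for the cycloid / brachistochrone density.
On `Ω = ℝ × (−2ρ, 0)`, with
`g(x,y) = x − ρ·arccos(1 + y/ρ) + ρ·√(1 − (1 + y/ρ)²)` and
`f(x,y) = (1/√(2ρ))(−x + ρ·arcsin(1 + y/ρ) − ρ·√(1 − (1 + y/ρ)²))`,
one has `∇f·∇g = 0` and `‖∇f‖ = 1/√(−y)`. -/
theorem statement9 (ρ : ℝ) (hρ : 0 < ρ) (p : ℝ × ℝ)
    (hp : p ∈ (univ : Set ℝ) ×ˢ Ioo (-(2 * ρ)) 0) :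
    dotp (grad (fun w : ℝ × ℝ => (1 / Real.sqrt (2 * ρ)) *
            (-w.1 + ρ * Real.arcsin (1 + w.2 / ρ)
              - ρ * Real.sqrt (1 - (1 + w.2 / ρ) ^ 2))) p)
        (grad (fun w : ℝ × ℝ => w.1 - ρ * Real.arccos (1 + w.2 / ρ)
              + ρ * Real.sqrt (1 - (1 + w.2 / ρ) ^ 2)) p) = 0 ∧
    elen (grad (fun w : ℝ × ℝ => (1 / Real.sqrt (2 * ρ)) *
            (-w.1 + ρ * Real.arcsin (1 + w.2 / ρ)
              - ρ * Real.sqrt (1 - (1 + w.2 / ρ) ^ 2))) p)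
      = 1 / Real.sqrt (-p.2) := by
  obtain ⟨-, hy1, hy2⟩ := hp
  obtain ⟨s, hs⟩ : ∃ s, s = 1 + p.2 / ρ := ⟨_, rfl⟩
  have hys : p.2 = ρ * (s - 1) := by rw [hs]; field_simp; ring
  have hs1 : s < 1 := by
    rw [hys] at hy2
    by_contra hc
    have := mul_nonneg hρ.le (by linarith : 0 ≤ s - 1)
    linarith
  have hs2 : -1 < s := by
    rw [hys] at hy1
    by_contra hc
    have := mul_nonneg hρ.le (by linarith : 0 ≤ -1 - s)
    linarith
  have hpos : 0 < 1 - s ^ 2 := by nlinarith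
  have hr : 0 < √(1 - s ^ 2) := Real.sqrt_pos.2 hpos
  have hr2 : √(1 - s ^ 2) ^ 2 = 1 - s ^ 2 := Real.sq_sqrt hpos.le
  have hin : HasDerivAt (fun y : ℝ => 1 + y / ρ) (1 / ρ) p.2 :=
    ((hasDerivAt_id p.2).div_const ρ).const_add 1
  have hasin : HasDerivAt (fun y : ℝ => Real.arcsin (1 + y / ρ))
      (1 / √(1 - s ^ 2) * (1 / ρ)) p.2 := by
    have := Real.hasDerivAt_arcsin (x := s) (by linarith) (by linarith)
    rw [hs] at this ⊢
    exact this.comp p.2 hin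
  have hacos : HasDerivAt (fun y : ℝ => Real.arccos (1 + y / ρ))
      (-(1 / √(1 - s ^ 2)) * (1 / ρ)) p.2 := by
    have := Real.hasDerivAt_arccos (x := s) (by linarith) (by linarith)
    rw [hs] at this ⊢
    exact HasDerivAt.comp (h₂ := Real.arccos) (h := fun y : ℝ => 1 + y / ρ) p.2 this hin
  have hsq : HasDerivAt (fun y : ℝ => √(1 - (1 + y / ρ) ^ 2))
      (-(2 * s * (1 / ρ)) / (2 * √(1 - s ^ 2))) p.2 := by
    have h := ((hin.pow 2).const_sub 1).sqrt (by
      have := hpos.ne'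
      rw [hs] at this
      simpa using this)
    rw [hs]
    simpa using h
  have hc2 : (1 / √(2 * ρ)) ^ 2 = 1 / (2 * ρ) := by
    rw [div_pow, Real.sq_sqrt (by positivity), one_pow]
  generalize 1 / √(2 * ρ) = c at hc2 ⊢
  generalize √(1 - s ^ 2) = r at *
  rw [grad_split (-c) (c * ((1 + s) / r))
      (fun y => c * (ρ * Real.arcsin (1 + y / ρ) - ρ * √(1 - (1 + y / ρ) ^ 2))) p
      (by
        refine (((hasin.const_mul ρ).sub (hsq.const_mul ρ)).const_mul c).congr_deriv ?_
        field_simp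
        try ring) _ (fun w => by ring),
    grad_split 1 ((1 - s) / r)
      (fun y => -(ρ * Real.arccos (1 + y / ρ)) + ρ * √(1 - (1 + y / ρ) ^ 2)) p
      (by
        refine (((hacos.const_mul ρ).neg.add (hsq.const_mul ρ))).congr_deriv ?_
        field_simp
        try ring) _ (fun w => by ring)]
  constructor
  · have h : (1 + s) / r * ((1 - s) / r) = 1 := by
      rw [div_mul_div_comm, ← sq, hr2, div_eq_one_iff_eq hpos.ne']; ring
    simp only [dotp]
    linear_combination c * h
  · simp only [elen]
    rw [one_div, ← Real.sqrt_inv]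
    congr 1
    rw [mul_pow, div_pow, hr2, neg_sq, hc2, hys]
    have h1 : 1 - s ≠ 0 := by linarith
    have h2 : 1 + s ≠ 0 := by linarith
    have e1 : 1 - s ^ 2 = (1 - s) * (1 + s) := by ring
    have e2 : -(ρ * (s - 1)) = ρ * (1 - s) := by ring
    rw [e1, e2]
    field_simp
    ring
end

section
/- Fix ε ∈ (0,1) and x₀ ∈ ℝ, and let Ω = ℝ × (0, 1/√(1 − ε²)). Let C = {(x,y) ∈ Ω : (1 − ε²)·(x − x₀) − √(1 − (1 − ε²)·y²) = 0} (an arc of the ellipse (1 − ε²)²·(x − x₀)² + (1 − ε²)·y² = 1 of eccentricity ε). Let P₁, P₂ ∈ C and let X* be a regular C¹ curve in Ω from P₁ to P₂ whose image is contained in C. Then for every C¹ curve X in Ω from P₁ to P₂ one has L_φ(X) ≥ L_φ(X*), where φ(x,y) = √(ε² + 1/y²). -/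
open Set

noncomputable def auxW (k y : ℝ) : ℝ := Real.sqrt (1 - k * y ^ 2)

noncomputable def auxS (k : ℝ) (p : ℝ × ℝ) : ℝ :=
  p.1 - auxW k p.2 - Real.log p.2 + Real.log (1 + auxW k p.2)

noncomputable def auxD (k : ℝ) (X : ℝ → ℝ × ℝ) (t : ℝ) : ℝ :=
  (derivWithin X (Icc 0 1) t).1
    - auxW k (X t).2 / (X t).2 * (derivWithin X (Icc 0 1) t).2

lemma aux_pos {k y : ℝ} (hk : 0 < k) (hy : y ∈ Ioo 0 (1 / Real.sqrt k)) :
    0 < 1 - k * y ^ 2 := by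
  have hs : 0 < Real.sqrt k := Real.sqrt_pos.2 hk
  have h1 : y * Real.sqrt k < 1 := (lt_div_iff₀ hs).1 hy.2
  have h2 : 0 < y * Real.sqrt k := mul_pos hy.1 hs
  have h3 : k * y ^ 2 = (y * Real.sqrt k) ^ 2 := by
    rw [mul_pow, Real.sq_sqrt hk.le]; ring
  rw [h3]; nlinarith

lemma aux_deriv {X : ℝ → ℝ × ℝ} (hX : ContDiffOn ℝ 1 X (Icc 0 1)) {t : ℝ}
    (ht : t ∈ Icc (0:ℝ) 1) :
    HasDerivWithinAt (fun s => (X s).1) (derivWithin X (Icc 0 1) t).1 (Icc 0 1) t ∧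
    HasDerivWithinAt (fun s => (X s).2) (derivWithin X (Icc 0 1) t).2 (Icc 0 1) t := by
  have h := ((hX.differentiableOn one_ne_zero) t ht).hasDerivWithinAt
  constructor
  · exact (ContinuousLinearMap.fst ℝ ℝ ℝ).hasFDerivAt.comp_hasDerivWithinAt t h
  · exact (ContinuousLinearMap.snd ℝ ℝ ℝ).hasFDerivAt.comp_hasDerivWithinAt t h

lemma aux_S_deriv {k : ℝ} (hk : 0 < k) {X : ℝ → ℝ × ℝ} (hX : ContDiffOn ℝ 1 X (Icc 0 1)) {t : ℝ}
    (ht : t ∈ Icc (0:ℝ) 1) (hy : (X t).2 ∈ Ioo 0 (1 / Real.sqrt k)) :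
    HasDerivWithinAt (fun s => auxS k (X s)) (auxD k X t) (Icc 0 1) t := by
  obtain ⟨h1, h2⟩ := aux_deriv hX ht
  have hp := aux_pos hk hy
  have hy0 := hy.1
  have hw : 0 < auxW k (X t).2 := Real.sqrt_pos.2 hp
  have hw2 : auxW k (X t).2 ^ 2 = 1 - k * (X t).2 ^ 2 := Real.sq_sqrt hp.le
  have hW := (((h2.pow 2).const_mul k).const_sub 1).sqrt hp.ne'
  have hl := h2.log hy0.ne'
  have hl2 := (hW.const_add 1).log (by
    have : 0 < 1 + auxW k (X t).2 := by linarith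
    exact this.ne')
  have := ((h1.sub hW).sub hl).add hl2
  refine this.congr_deriv ?_
  unfold auxD
  simp only [Pi.pow_apply]
  change _ - _ / (2 * auxW k (X t).2) - _ + _ / (2 * auxW k (X t).2) / (1 + auxW k (X t).2) = _
  set w := auxW k (X t).2
  set y := (X t).2
  set b := (derivWithin X (Icc 0 1) t).2
  have : 1 + w ≠ 0 := by positivity
  have hk' : k * y ^ 2 = 1 - w ^ 2 := by linarith
  field_simp
  push_cast
  simp only [Nat.add_one_sub_one, pow_one]
  linear_combination (2 * b * w) * hk'

lemma aux_D_cont {k : ℝ} {X : ℝ → ℝ × ℝ} (hX : ContDiffOn ℝ 1 X (Icc 0 1))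
    (hy : ∀ t ∈ Icc (0:ℝ) 1, 0 < (X t).2) :
    ContinuousOn (auxD k X) (Icc 0 1) := by
  have hd := hX.continuousOn_derivWithin (uniqueDiffOn_Icc zero_lt_one) le_rfl
  have hc := hX.continuousOn
  unfold auxD auxW
  refine hd.fst.sub (ContinuousOn.mul (ContinuousOn.div ?_ hc.snd fun t ht => (hy t ht).ne') hd.snd)
  exact (continuousOn_const.sub (continuousOn_const.mul (hc.snd.pow 2))).sqrt

lemma aux_len_cont {c : ℝ} {X : ℝ → ℝ × ℝ} (hX : ContDiffOn ℝ 1 X (Icc 0 1))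
    (hy : ∀ t ∈ Icc (0:ℝ) 1, 0 < (X t).2) :
    ContinuousOn (fun t => Real.sqrt (c + 1 / (X t).2 ^ 2) * elen (derivWithin X (Icc 0 1) t))
      (Icc 0 1) := by
  have hd := hX.continuousOn_derivWithin (uniqueDiffOn_Icc zero_lt_one) le_rfl
  have hc := hX.continuousOn
  unfold elen
  refine ContinuousOn.mul ?_ ((hd.fst.pow 2).add (hd.snd.pow 2)).sqrt
  exact (continuousOn_const.add (continuousOn_const.div (hc.snd.pow 2)
    fun t ht => (pow_pos (hy t ht) 2).ne')).sqrt

lemma aux_FTC {k : ℝ} (hk : 0 < k) {X : ℝ → ℝ × ℝ} (hX : ContDiffOn ℝ 1 X (Icc 0 1))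
    (hy : ∀ t ∈ Icc (0:ℝ) 1, (X t).2 ∈ Ioo 0 (1 / Real.sqrt k)) :
    ∫ t in (0:ℝ)..1, auxD k X t = auxS k (X 1) - auxS k (X 0) := by
  have hD : ContinuousOn (auxD k X) (Icc 0 1) := aux_D_cont hX fun t ht => (hy t ht).1
  refine intervalIntegral.integral_eq_sub_of_hasDerivAt_of_le (f := fun s => auxS k (X s))
    zero_le_one
    (fun t ht => (aux_S_deriv hk hX ht (hy t ht)).continuousWithinAt) (fun t ht => ?_)
    (hD.intervalIntegrable_of_Icc zero_le_one)
  exact (aux_S_deriv hk hX (Ioo_subset_Icc_self ht) (hy t (Ioo_subset_Icc_self ht))).hasDerivAt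
    (Icc_mem_nhds ht.1 ht.2)

/-- squared identity -/
lemma aux_sq_s12 {k y : ℝ} (hk : 0 < k) (hy : y ∈ Ioo 0 (1 / Real.sqrt k)) :
    1 - k + 1 / y ^ 2 = 1 + (auxW k y / y) ^ 2 := by
  have hw2 : auxW k y ^ 2 = 1 - k * y ^ 2 := Real.sq_sqrt (aux_pos hk hy).le
  have := hy.1
  rw [div_pow, hw2]; field_simp; ring

lemma aux_bound (r : ℝ) (v : ℝ × ℝ) :
    |v.1 - r * v.2| ≤ Real.sqrt (1 + r ^ 2) * elen v := by
  unfold elen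
  rw [← Real.sqrt_mul (by positivity)]
  apply Real.abs_le_sqrt
  nlinarith [sq_nonneg (v.2 + r * v.1)]

lemma aux_bound_eq (r : ℝ) (v : ℝ × ℝ) (h : v.2 + r * v.1 = 0) :
    Real.sqrt (1 + r ^ 2) * elen v = |v.1 - r * v.2| := by
  unfold elen
  rw [← Real.sqrt_mul (by positivity), ← Real.sqrt_sq_eq_abs]
  congr 1
  linear_combination (v.2 + r * v.1) * h

/-- the elliptic arc `(1 − ε²)(x − x₀) − √(1 − (1 − ε²)y²) = 0`
(eccentricity `ε ∈ (0,1)`) in the strip `ℝ × (0, 1/√(1 − ε²))` is a weighted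
length-minimizer for the density `√(ε² + 1/y²)`. -/
theorem statement12 (ε x₀ : ℝ) (hε : ε ∈ Ioo (0:ℝ) 1) (P₁ P₂ : ℝ × ℝ)
    (hP₁ : P₁ ∈ (univ : Set ℝ) ×ˢ Ioo 0 (1 / Real.sqrt (1 - ε ^ 2)))
    (hP₁' : (1 - ε ^ 2) * (P₁.1 - x₀) - Real.sqrt (1 - (1 - ε ^ 2) * P₁.2 ^ 2) = 0)
    (hP₂ : P₂ ∈ (univ : Set ℝ) ×ˢ Ioo 0 (1 / Real.sqrt (1 - ε ^ 2)))
    (hP₂' : (1 - ε ^ 2) * (P₂.1 - x₀) - Real.sqrt (1 - (1 - ε ^ 2) * P₂.2 ^ 2) = 0)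
    (Xstar : ℝ → ℝ × ℝ)
    (hXstar : IsC1CurveIn ((univ : Set ℝ) ×ˢ Ioo 0 (1 / Real.sqrt (1 - ε ^ 2))) P₁ P₂ Xstar)
    (hreg : IsRegularCurve Xstar)
    (hlevel : ∀ t ∈ Icc (0:ℝ) 1,
      (1 - ε ^ 2) * ((Xstar t).1 - x₀) - Real.sqrt (1 - (1 - ε ^ 2) * (Xstar t).2 ^ 2) = 0)
    (X : ℝ → ℝ × ℝ)
    (hX : IsC1CurveIn ((univ : Set ℝ) ×ˢ Ioo 0 (1 / Real.sqrt (1 - ε ^ 2))) P₁ P₂ X) :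
    wLen (fun p => Real.sqrt (ε ^ 2 + 1 / p.2 ^ 2)) X
      ≥ wLen (fun p => Real.sqrt (ε ^ 2 + 1 / p.2 ^ 2)) Xstar := by
  have hk : 0 < 1 - ε ^ 2 := by nlinarith [hε.1, hε.2]
  obtain ⟨hXc, hXm, hX0, hX1⟩ := hX
  obtain ⟨hYc, hYm, hY0, hY1⟩ := hXstar
  have hXy : ∀ t ∈ Icc (0:ℝ) 1, (X t).2 ∈ Ioo 0 (1 / Real.sqrt (1 - ε ^ 2)) :=
    fun t ht => (hXm t ht).2
  have hYy : ∀ t ∈ Icc (0:ℝ) 1, (Xstar t).2 ∈ Ioo 0 (1 / Real.sqrt (1 - ε ^ 2)) :=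
    fun t ht => (hYm t ht).2
  clear hXm hYm hP₁ hP₂ hP₁' hP₂'
  have hε2 : ε ^ 2 = 1 - (1 - ε ^ 2) := by ring
  generalize 1 - ε ^ 2 = k at *
  rw [hε2]
  have hFX := aux_FTC hk hXc hXy
  have hFY := aux_FTC hk hYc hYy
  rw [hX0, hX1] at hFX
  rw [hY0, hY1, ← hFX] at hFY
  have hDX : ContinuousOn (auxD k X) (Icc 0 1) := aux_D_cont hXc fun t ht => (hXy t ht).1
  have hDY : ContinuousOn (auxD k Xstar) (Icc 0 1) := aux_D_cont hYc fun t ht => (hYy t ht).1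
  -- lower bound for an arbitrary curve
  have hlow : |∫ t in (0:ℝ)..1, auxD k X t|
      ≤ wLen (fun p => Real.sqrt (1 - k + 1 / p.2 ^ 2)) X := by
    refine (intervalIntegral.abs_integral_le_integral_abs zero_le_one).trans ?_
    refine intervalIntegral.integral_mono_on zero_le_one
      (hDX.abs.intervalIntegrable_of_Icc zero_le_one)
      ((aux_len_cont hXc fun t ht => (hXy t ht).1).intervalIntegrable_of_Icc zero_le_one) ?_
    intro t ht
    simp only
    rw [aux_sq_s12 hk (hXy t ht)]
    exact aux_bound _ _
  -- tangency along the ellipse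
  have htan : ∀ t ∈ Icc (0:ℝ) 1, (derivWithin Xstar (Icc 0 1) t).2
      + auxW k (Xstar t).2 / (Xstar t).2 * (derivWithin Xstar (Icc 0 1) t).1 = 0 := by
    intro t ht
    obtain ⟨h1, h2⟩ := aux_deriv hYc ht
    have hA := (((h1.sub_const x₀).const_mul k).pow 2).add ((h2.pow 2).const_mul k)
    have hw : k * ((Xstar t).1 - x₀) = auxW k (Xstar t).2 := by
      have := hlevel t ht
      unfold auxW; linarith
    have hB : HasDerivWithinAt (fun _ : ℝ => (1:ℝ)) 0 (Icc 0 1) t := hasDerivWithinAt_const _ _ _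
    have hcongr : ∀ s ∈ Icc (0:ℝ) 1,
        (k * ((Xstar s).1 - x₀)) ^ 2 + k * (Xstar s).2 ^ 2 = 1 := by
      intro s hs
      have h3 := hlevel s hs
      have h4 : k * ((Xstar s).1 - x₀) = Real.sqrt (1 - k * (Xstar s).2 ^ 2) := by linarith
      rw [h4, Real.sq_sqrt (aux_pos hk (hYy s hs)).le]; ring
    have hA' := hB.congr (f₁ := fun s => (k * ((Xstar s).1 - x₀)) ^ 2 + k * (Xstar s).2 ^ 2)
      hcongr (hcongr t ht)
    have he := (uniqueDiffOn_Icc (zero_lt_one' ℝ) t ht).eq_deriv _ hA hA'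
    rw [hw] at he
    have hy0 := (hYy t ht).1
    field_simp
    push_cast at he
    simp only [Nat.add_one_sub_one, pow_one] at he
    have hk2 : (2 * k) ≠ 0 := by positivity
    apply mul_left_cancel₀ hk2
    linear_combination he
  have heq : wLen (fun p => Real.sqrt (1 - k + 1 / p.2 ^ 2)) Xstar
      = ∫ t in (0:ℝ)..1, |auxD k Xstar t| := by
    refine intervalIntegral.integral_congr ?_
    intro t ht
    rw [uIcc_of_le zero_le_one] at ht
    simp only
    rw [aux_sq_s12 hk (hYy t ht)]
    exact aux_bound_eq _ _ (htan t ht)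
  have hne : ∀ t ∈ Icc (0:ℝ) 1, auxD k Xstar t ≠ 0 := by
    intro t ht h0
    have h1 := htan t ht
    unfold auxD at h0
    apply hreg t ht
    set r := auxW k (Xstar t).2 / (Xstar t).2
    have h3 : (derivWithin Xstar (Icc 0 1) t).2 * (1 + r ^ 2) = 0 := by
      linear_combination h1 - r * h0
    have h4 : (derivWithin Xstar (Icc 0 1) t).2 = 0 := by
      rcases mul_eq_zero.1 h3 with h | h
      · exact h
      · nlinarith [sq_nonneg r]
    have h5 : (derivWithin Xstar (Icc 0 1) t).1 = 0 := by
      rw [h4] at h0; linarith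
    exact Prod.ext h5 h4
  have habs : ∫ t in (0:ℝ)..1, |auxD k Xstar t| = |∫ t in (0:ℝ)..1, auxD k Xstar t| := by
    have hsign : (∀ t ∈ Icc (0:ℝ) 1, 0 ≤ auxD k Xstar t) ∨
        (∀ t ∈ Icc (0:ℝ) 1, auxD k Xstar t ≤ 0) := by
      by_contra hcon
      push Not at hcon
      obtain ⟨⟨a, ha, ha'⟩, ⟨b, hb, hb'⟩⟩ := hcon
      obtain ⟨c, hc, hc'⟩ := isPreconnected_Icc.intermediate_value ha hb hDY ⟨ha'.le, hb'.le⟩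
      exact hne c hc hc'
    rcases hsign with h | h
    · rw [abs_of_nonneg (intervalIntegral.integral_nonneg zero_le_one h)]
      refine intervalIntegral.integral_congr fun t ht => ?_
      rw [uIcc_of_le zero_le_one] at ht
      exact abs_of_nonneg (h t ht)
    · have h' : ∫ t in (0:ℝ)..1, |auxD k Xstar t| = - ∫ t in (0:ℝ)..1, auxD k Xstar t := by
        rw [← intervalIntegral.integral_neg]
        refine intervalIntegral.integral_congr fun t ht => ?_
        rw [uIcc_of_le zero_le_one] at ht
        exact abs_of_nonpos (h t ht)
      rw [h', ← abs_neg, abs_of_nonneg]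
      rw [← h']
      exact intervalIntegral.integral_nonneg zero_le_one fun t _ => abs_nonneg _
  rw [ge_iff_le, heq, habs, hFY]
  exact hlow
end

section
/- Let Ω = ℂ \ {z ∈ ℂ : Im z = 0 and Re z ≤ 0} be the slit plane, identified with {(r·cos θ, r·sin θ) : r > 0, θ ∈ (−π, π)}. Fix r₀ > 0, θ₀ ∈ (−π, π), and λ ∈ ℝ, and let S = {(r·cos θ, r·sin θ) : θ ∈ (−π, π), r = r₀·e^{λ·(θ − θ₀)}} be the arc of the logarithmic spiral contained in Ω. Let P₁, P₂ ∈ S and let X* be a regular C¹ curve in Ω from P₁ to P₂ whose image is contained in S. Then for every C¹ curve X in Ω from P₁ to P₂ one has L_φ(X) ≥ L_φ(X*), where φ(x,y) = 1/√(x² + y²). That is, arcs of logarithmic spirals are weighted length-minimizers for the radial density 1/√(x² + y²). -/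
open Set

/-- The logarithmic lift of a C¹ curve in the slit plane. -/
lemma log_lift (P₁ P₂ : ℝ × ℝ) (X : ℝ → ℝ × ℝ)
    (hX : IsC1CurveIn {w : ℝ × ℝ | ¬(w.2 = 0 ∧ w.1 ≤ 0)} P₁ P₂ X) :
    ∃ V : ℝ → ℂ, ContinuousOn V (Icc 0 1) ∧
      (∀ t ∈ Icc (0:ℝ) 1, HasDerivWithinAt
        (fun t => Complex.log (Complex.equivRealProdCLM.symm (X t))) (V t) (Icc 0 1) t) ∧
      (∀ t ∈ Icc (0:ℝ) 1, 1 / Real.sqrt ((X t).1 ^ 2 + (X t).2 ^ 2) *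
        elen (derivWithin X (Icc 0 1) t) = ‖V t‖) ∧
      (∀ t ∈ Icc (0:ℝ) 1, derivWithin X (Icc 0 1) t ≠ 0 → V t ≠ 0) ∧
      (∫ t in (0:ℝ)..1, V t) = Complex.log (Complex.equivRealProdCLM.symm P₂)
        - Complex.log (Complex.equivRealProdCLM.symm P₁) := by
  obtain ⟨hC, hΩ, h0, h1⟩ := hX
  have hslit : ∀ t ∈ Icc (0:ℝ) 1,
      (Complex.equivRealProdCLM.symm (X t)) ∈ Complex.slitPlane := by
    intro t ht
    have := hΩ t ht
    simp only [mem_setOf_eq] at this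
    rw [Complex.mem_slitPlane_iff]
    simp only [Complex.equivRealProdCLM_symm_apply_re, Complex.equivRealProdCLM_symm_apply_im]
    by_contra hcon
    push Not at hcon
    exact this ⟨hcon.2, hcon.1⟩
  have hnorm : ∀ p : ℝ × ℝ, ‖Complex.equivRealProdCLM.symm p‖ = Real.sqrt (p.1 ^ 2 + p.2 ^ 2) := by
    intro p
    rw [Complex.norm_eq_sqrt_sq_add_sq]
    simp
  have hderiv : ∀ t ∈ Icc (0:ℝ) 1, HasDerivWithinAt
      (fun t => Complex.equivRealProdCLM.symm (X t))
      (Complex.equivRealProdCLM.symm (derivWithin X (Icc 0 1) t)) (Icc 0 1) t := by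
    intro t ht
    have hd := ((hC.differentiableOn one_ne_zero) t ht).hasDerivWithinAt
    exact (Complex.equivRealProdCLM.symm.toContinuousLinearMap.hasFDerivAt
      (x := X t)).comp_hasDerivWithinAt t hd
  have hcd : ContinuousOn (derivWithin X (Icc 0 1)) (Icc 0 1) :=
    hC.continuousOn_derivWithin (uniqueDiffOn_Icc zero_lt_one) le_rfl
  have hVc : ContinuousOn (fun t => Complex.equivRealProdCLM.symm (derivWithin X (Icc 0 1) t) /
      Complex.equivRealProdCLM.symm (X t)) (Icc 0 1) := by
    refine ContinuousOn.div ?_ ?_ ?_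
    · exact Complex.equivRealProdCLM.symm.continuous.comp_continuousOn hcd
    · exact Complex.equivRealProdCLM.symm.continuous.comp_continuousOn hC.continuousOn
    · intro t ht
      exact Complex.slitPlane_ne_zero (hslit t ht)
  have hW : ∀ t ∈ Icc (0:ℝ) 1, HasDerivWithinAt
      (fun t => Complex.log (Complex.equivRealProdCLM.symm (X t)))
      (Complex.equivRealProdCLM.symm (derivWithin X (Icc 0 1) t) /
        Complex.equivRealProdCLM.symm (X t)) (Icc 0 1) t :=
    fun t ht => (hderiv t ht).clog_real (hslit t ht)
  refine ⟨_, hVc, hW, ?_, ?_, ?_⟩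
  · intro t ht
    rw [norm_div, hnorm, hnorm, elen]
    ring
  · intro t ht hne
    refine div_ne_zero ?_ (Complex.slitPlane_ne_zero (hslit t ht))
    simpa using hne
  · rw [intervalIntegral.integral_eq_sub_of_hasDerivAt_of_le zero_le_one
      (f := fun t => Complex.log (Complex.equivRealProdCLM.symm (X t)))]
    · simp only [h0, h1]
    · exact fun t ht => (hW t ht).continuousWithinAt
    · intro t ht
      exact (hW t (Ioo_subset_Icc_self ht)).hasDerivAt (Icc_mem_nhds ht.1 ht.2)
    · exact hVc.intervalIntegrable_of_Icc zero_le_one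

lemma wLen_eq (X : ℝ → ℝ × ℝ) (V : ℝ → ℂ)
    (h : ∀ t ∈ Icc (0:ℝ) 1, 1 / Real.sqrt ((X t).1 ^ 2 + (X t).2 ^ 2) *
        elen (derivWithin X (Icc 0 1) t) = ‖V t‖) :
    wLen (fun p => 1 / Real.sqrt (p.1 ^ 2 + p.2 ^ 2)) X = ∫ t in (0:ℝ)..1, ‖V t‖ := by
  unfold wLen
  refine intervalIntegral.integral_congr ?_
  intro t ht
  rw [uIcc_of_le zero_le_one] at ht
  exact h t ht

lemma integral_abs_eq (g : ℝ → ℝ) (hg : ContinuousOn g (Icc 0 1))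
    (hne : ∀ t ∈ Icc (0:ℝ) 1, g t ≠ 0) :
    ∫ t in (0:ℝ)..1, |g t| = |∫ t in (0:ℝ)..1, g t| := by
  have hsign : (∀ t ∈ Icc (0:ℝ) 1, 0 ≤ g t) ∨ (∀ t ∈ Icc (0:ℝ) 1, g t ≤ 0) := by
    by_contra hcon
    push Not at hcon
    obtain ⟨⟨a, ha, hga⟩, ⟨b, hb, hgb⟩⟩ := hcon
    obtain ⟨c, hc, hgc⟩ := isPreconnected_Icc.intermediate_value ha hb hg ⟨hga.le, hgb.le⟩
    exact hne c hc hgc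
  rcases hsign with h | h
  · rw [abs_of_nonneg (intervalIntegral.integral_nonneg zero_le_one h)]
    refine intervalIntegral.integral_congr ?_
    intro t ht
    rw [uIcc_of_le zero_le_one] at ht
    exact abs_of_nonneg (h t ht)
  · have h2 : 0 ≤ ∫ t in (0:ℝ)..1, -g t :=
      intervalIntegral.integral_nonneg zero_le_one (fun t ht => neg_nonneg.2 (h t ht))
    rw [intervalIntegral.integral_neg] at h2
    rw [abs_of_nonpos (by linarith), ← intervalIntegral.integral_neg]
    refine intervalIntegral.integral_congr ?_
    intro t ht
    rw [uIcc_of_le zero_le_one] at ht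
    exact abs_of_nonpos (h t ht)

lemma log_spiral (r₀ θ₀ l θ : ℝ) (hr₀ : 0 < r₀) (hθ : θ ∈ Ioo (-Real.pi) Real.pi) :
    Complex.log (Complex.equivRealProdCLM.symm (r₀ * Real.exp (l * (θ - θ₀)) * Real.cos θ,
            r₀ * Real.exp (l * (θ - θ₀)) * Real.sin θ)) =
      ⟨Real.log r₀ + l * (θ - θ₀), θ⟩ := by
  have hpos : 0 < r₀ * Real.exp (l * (θ - θ₀)) := by positivity
  have : Complex.equivRealProdCLM.symm (r₀ * Real.exp (l * (θ - θ₀)) * Real.cos θ,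
            r₀ * Real.exp (l * (θ - θ₀)) * Real.sin θ) =
      Complex.exp ⟨Real.log r₀ + l * (θ - θ₀), θ⟩ := by
    apply Complex.ext
    · rw [Complex.exp_re]
      simp [Real.exp_add, Real.exp_log hr₀]
    · rw [Complex.exp_im]
      simp [Real.exp_add, Real.exp_log hr₀]
  rw [this, Complex.log_exp hθ.1 hθ.2.le]

/-- arcs of the logarithmic spiral `r = r₀·e^{λ(θ − θ₀)}` in the
slit plane `ℝ² ∖ {(x, 0) : x ≤ 0}` are weighted length-minimizers for the
radial density `1/√(x² + y²)`. -/
theorem statement18 (r₀ θ₀ l : ℝ) (hr₀ : 0 < r₀) (hθ₀ : θ₀ ∈ Ioo (-Real.pi) Real.pi)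
    (P₁ P₂ : ℝ × ℝ)
    (hP₁ : P₁ ∈ {w : ℝ × ℝ | ¬(w.2 = 0 ∧ w.1 ≤ 0)})
    (hP₁' : ∃ θ ∈ Ioo (-Real.pi) Real.pi,
      P₁ = (r₀ * Real.exp (l * (θ - θ₀)) * Real.cos θ,
            r₀ * Real.exp (l * (θ - θ₀)) * Real.sin θ))
    (hP₂ : P₂ ∈ {w : ℝ × ℝ | ¬(w.2 = 0 ∧ w.1 ≤ 0)})
    (hP₂' : ∃ θ ∈ Ioo (-Real.pi) Real.pi,
      P₂ = (r₀ * Real.exp (l * (θ - θ₀)) * Real.cos θ,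
            r₀ * Real.exp (l * (θ - θ₀)) * Real.sin θ))
    (Xstar : ℝ → ℝ × ℝ)
    (hXstar : IsC1CurveIn {w : ℝ × ℝ | ¬(w.2 = 0 ∧ w.1 ≤ 0)} P₁ P₂ Xstar)
    (hreg : IsRegularCurve Xstar)
    (hlevel : ∀ t ∈ Icc (0:ℝ) 1, ∃ θ ∈ Ioo (-Real.pi) Real.pi,
      Xstar t = (r₀ * Real.exp (l * (θ - θ₀)) * Real.cos θ,
                 r₀ * Real.exp (l * (θ - θ₀)) * Real.sin θ))
    (X : ℝ → ℝ × ℝ)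
    (hX : IsC1CurveIn {w : ℝ × ℝ | ¬(w.2 = 0 ∧ w.1 ≤ 0)} P₁ P₂ X) :
    wLen (fun p => 1 / Real.sqrt (p.1 ^ 2 + p.2 ^ 2)) X
      ≥ wLen (fun p => 1 / Real.sqrt (p.1 ^ 2 + p.2 ^ 2)) Xstar := by
  obtain ⟨V, hVc, -, hVl, -, hVi⟩ := log_lift P₁ P₂ X hX
  obtain ⟨U, hUc, hUd, hUl, hUr, hUi⟩ := log_lift P₁ P₂ Xstar hXstar
  rw [wLen_eq X V hVl, wLen_eq Xstar U hUl]
  have hle : ‖∫ t in (0:ℝ)..1, V t‖ ≤ ∫ t in (0:ℝ)..1, ‖V t‖ :=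
    intervalIntegral.norm_integral_le_integral_norm zero_le_one
  rw [hVi, ← hUi] at hle
  refine le_trans (le_of_eq ?_) hle
  have hrel : ∀ t ∈ Icc (0:ℝ) 1, (U t).re = l * (U t).im := by
    intro t ht
    have hre := (Complex.reCLM.hasFDerivAt
      (x := Complex.log (Complex.equivRealProdCLM.symm (Xstar t)))).comp_hasDerivWithinAt t
        (hUd t ht)
    have him := (Complex.imCLM.hasFDerivAt
      (x := Complex.log (Complex.equivRealProdCLM.symm (Xstar t)))).comp_hasDerivWithinAt t
        (hUd t ht)
    have him2 := (him.const_mul l).add_const (Real.log r₀ - l * θ₀)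
    have hEq : ∀ s ∈ Icc (0:ℝ) 1,
        (Complex.log (Complex.equivRealProdCLM.symm (Xstar s))).re =
        l * (Complex.log (Complex.equivRealProdCLM.symm (Xstar s))).im
          + (Real.log r₀ - l * θ₀) := by
      intro s hs
      obtain ⟨θ, hθ, hXs⟩ := hlevel s hs
      rw [hXs, log_spiral r₀ θ₀ l θ hr₀ hθ]
      ring
    have him3 := him2.congr hEq (hEq t ht)
    exact (uniqueDiffOn_Icc zero_lt_one t ht).eq_deriv _ hre him3
  have hform : ∀ t ∈ Icc (0:ℝ) 1, U t = ((U t).im : ℂ) * (⟨l, 1⟩ : ℂ) := by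
    intro t ht
    apply Complex.ext
    · simp [hrel t ht, mul_comm]
    · simp
  have hne : ∀ t ∈ Icc (0:ℝ) 1, (U t).im ≠ 0 := by
    intro t ht h0
    apply hUr t ht (hreg t ht)
    rw [hform t ht, h0]
    simp
  have e1 : ∫ t in (0:ℝ)..1, ‖U t‖ = ∫ t in (0:ℝ)..1, |(U t).im| * ‖(⟨l, 1⟩ : ℂ)‖ := by
    refine intervalIntegral.integral_congr ?_
    intro t ht
    rw [uIcc_of_le zero_le_one] at ht
    have := congrArg norm (hform t ht)
    rwa [norm_mul, Complex.norm_real] at this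
  have e2 : ∫ t in (0:ℝ)..1, U t = ∫ t in (0:ℝ)..1, ((U t).im : ℂ) * (⟨l, 1⟩ : ℂ) := by
    refine intervalIntegral.integral_congr ?_
    intro t ht
    rw [uIcc_of_le zero_le_one] at ht
    exact hform t ht
  rw [e1, e2, intervalIntegral.integral_mul_const, intervalIntegral.integral_mul_const,
    intervalIntegral.integral_ofReal, norm_mul, Complex.norm_real, Real.norm_eq_abs,
    integral_abs_eq (fun t => (U t).im) (Complex.continuous_im.comp_continuousOn hUc) hne]
end
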